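/- Fix β > −1. Let u be a bounded function of (ρ,θ,t) on (0,∞)×ℝ×(−∞,0), 2π-periodic in θ, twice continuously differentiable in (ρ,θ) and once in t, solving pointwise the heat equation ∂_t u = △̃u on the infinite cone. Suppose that for every R > 0 and T > 0, max_{t∈[−T,0]} ∫₀^{2π}∫₀^R |∇̃u|² dṼ + ∫_{−T}^0 ∫₀^{2π}∫₀^R |∂_t u|² dṼ dt < ∞. Then u is constant. -/

import Mathlib

open Real MeasureTheory Set

open scoped ENNReal

/-- The cone Laplacian `△̃ = ∂²/∂ρ² + ρ⁻¹ ∂/∂ρ + (β+1)⁻² ρ⁻² ∂²/∂θ²` applied to the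
spatial slice of a function `u(ρ,θ,t)`. -/
noncomputable def coneLapT (β : ℝ) (u : ℝ → ℝ → ℝ → ℝ) (ρ θ t : ℝ) : ℝ :=
  deriv (fun r => deriv (fun r' => u r' θ t) r) ρ
    + ρ⁻¹ * deriv (fun r => u r θ t) ρ
    + ((β + 1) ^ 2)⁻¹ * (ρ ^ 2)⁻¹ * deriv (fun s => deriv (fun s' => u ρ s' t) s) θ

/-- `|∇̃u|² = |∂_ρ u|² + ((β+1)ρ)⁻² |∂_θ u|²` for the cone metric. -/
noncomputable def gradSq (β : ℝ) (u : ℝ → ℝ → ℝ → ℝ) (ρ θ t : ℝ) : ℝ :=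
  (deriv (fun r => u r θ t) ρ) ^ 2
    + (((β + 1) * ρ) ^ 2)⁻¹ * (deriv (fun s => u ρ s t) θ) ^ 2

namespace ConeLiouville

/-- partial derivative in the first variable -/
noncomputable def dx (f : ℝ × ℝ → ℝ) (p : ℝ × ℝ) : ℝ := fderiv ℝ f p (1, 0)
/-- partial derivative in the second variable -/
noncomputable def dy (f : ℝ × ℝ → ℝ) (p : ℝ × ℝ) : ℝ := fderiv ℝ f p (0, 1)
/-- one period of the truncated cylinder -/
def box (a : ℝ) : Set (ℝ × ℝ) := Icc ((-a, 0) : ℝ × ℝ) (a, 2 * π)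

lemma box_compact (a : ℝ) : IsCompact (box a) := isCompact_Icc

lemma box_meas (a : ℝ) : MeasurableSet (box a) := measurableSet_Icc

lemma cont_int {F : ℝ × ℝ → ℝ} (hF : Continuous F) (a : ℝ) : IntegrableOn F (box a) :=
  hF.continuousOn.integrableOn_compact (box_compact a)

lemma dx_contDiff {f : ℝ × ℝ → ℝ} (hf : ContDiff ℝ 2 f) : ContDiff ℝ 1 (dx f) := by
  unfold dx
  exact (hf.fderiv_right (m := 1) (by norm_num)).clm_apply contDiff_const

lemma dy_contDiff {f : ℝ × ℝ → ℝ} (hf : ContDiff ℝ 2 f) : ContDiff ℝ 1 (dy f) := by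
  unfold dy
  exact (hf.fderiv_right (m := 1) (by norm_num)).clm_apply contDiff_const

lemma dx_cont {f : ℝ × ℝ → ℝ} (hf : ContDiff ℝ 1 f) : Continuous (dx f) := by
  unfold dx
  exact (hf.continuous_fderiv (by norm_num)).clm_apply continuous_const

lemma dy_cont {f : ℝ × ℝ → ℝ} (hf : ContDiff ℝ 1 f) : Continuous (dy f) := by
  unfold dy
  exact (hf.continuous_fderiv (by norm_num)).clm_apply continuous_const

lemma dx_mul {f g : ℝ × ℝ → ℝ} (hf : ContDiff ℝ 1 f) (hg : ContDiff ℝ 1 g) (p : ℝ × ℝ) :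
    dx (fun p => f p * g p) p = f p * dx g p + dx f p * g p := by
  have h1 := hf.differentiable (by norm_num) p
  have h2 := hg.differentiable (by norm_num) p
  unfold dx
  rw [fderiv_fun_mul h1 h2]
  simp; ring

lemma dy_mul {f g : ℝ × ℝ → ℝ} (hf : ContDiff ℝ 1 f) (hg : ContDiff ℝ 1 g) (p : ℝ × ℝ) :
    dy (fun p => f p * g p) p = f p * dy g p + dy f p * g p := by
  have h1 := hf.differentiable (by norm_num) p
  have h2 := hg.differentiable (by norm_num) p
  unfold dy
  rw [fderiv_fun_mul h1 h2]
  simp; ring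

lemma hasFDerivAt_cfst {c : ℝ → ℝ} (hc : ContDiff ℝ 1 c) (p : ℝ × ℝ) :
    HasFDerivAt (fun p : ℝ × ℝ => c p.1)
      ((ContinuousLinearMap.toSpanSingleton ℝ (deriv c p.1)).comp (ContinuousLinearMap.fst ℝ ℝ ℝ)) p := by
  have h := (hc.differentiable (by norm_num) p.1).hasDerivAt.hasFDerivAt
  exact h.comp p _root_.hasFDerivAt_fst

lemma dx_fst {c : ℝ → ℝ} (hc : ContDiff ℝ 1 c) (p : ℝ × ℝ) :
    dx (fun p => c p.1) p = deriv c p.1 := by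
  unfold dx
  rw [(hasFDerivAt_cfst hc p).fderiv]; simp

lemma dy_fst {c : ℝ → ℝ} (hc : ContDiff ℝ 1 c) (p : ℝ × ℝ) :
    dy (fun p => c p.1) p = 0 := by
  unfold dy
  rw [(hasFDerivAt_cfst hc p).fderiv]; simp

lemma dy_per {f : ℝ × ℝ → ℝ} (hp : ∀ x y, f (x, y + 2 * π) = f (x, y)) (x : ℝ) :
    dy f (x, 2 * π) = dy f (x, 0) := by
  have h : (fun p => f (p + (0, 2 * π))) = f := by
    funext p
    obtain ⟨a, b⟩ := p
    simpa using hp a b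
  unfold dy
  have h2 := fderiv_comp_add_right (𝕜 := ℝ) (f := f) (x := ((x, 0) : ℝ × ℝ)) (0, 2 * π)
  rw [h] at h2
  simp at h2
  rw [h2]

lemma divergence {F H : ℝ × ℝ → ℝ} (hF : ContDiff ℝ 1 F) (hH : ContDiff ℝ 1 H) {a : ℝ}
    (ha : 0 ≤ a) (h1 : ∀ y, F (a, y) = 0) (h2 : ∀ y, F (-a, y) = 0)
    (h3 : ∀ x, H (x, 2 * π) = H (x, 0)) :
    ∫ p in box a, (dx F p + dy H p) = 0 := by
  have hle : ((-a, 0) : ℝ × ℝ) ≤ (a, 2 * π) := by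
    constructor
    · simp; linarith
    · simp; positivity
  have := integral_divergence_prod_Icc_of_hasFDerivAt_of_le F H (fderiv ℝ F) (fderiv ℝ H)
    (-a, 0) (a, 2 * π) hle hF.continuous.continuousOn hH.continuous.continuousOn
    (fun x _ => (hF.differentiable (by norm_num) x).hasFDerivAt)
    (fun x _ => (hH.differentiable (by norm_num) x).hasFDerivAt)
    (cont_int ((dx_cont hF).add (dy_cont hH)) a)
  unfold box dx dy
  rw [this]
  simp [h1, h2, h3]

/-- flat energy density with the weight `κ` in the angular direction -/
noncomputable def gdot (κ : ℝ) (w f : ℝ × ℝ → ℝ) (p : ℝ × ℝ) : ℝ :=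
  dx w p * dx f p + κ * (dy w p * dy f p)

/-- flat Laplacian -/
noncomputable def lap (κ : ℝ) (f : ℝ × ℝ → ℝ) (p : ℝ × ℝ) : ℝ :=
  dx (dx f) p + κ * dy (dy f) p

lemma lap_cont {κ : ℝ} {f : ℝ × ℝ → ℝ} (hf : ContDiff ℝ 2 f) : Continuous (lap κ f) := by
  unfold lap
  exact (dx_cont (dx_contDiff hf)).add (continuous_const.mul (dy_cont (dy_contDiff hf)))

lemma gdot_cont {κ : ℝ} {w f : ℝ × ℝ → ℝ} (hw : ContDiff ℝ 2 w) (hf : ContDiff ℝ 2 f) :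
    Continuous (gdot κ w f) := by
  unfold gdot
  have h1 := (dx_contDiff hf).continuous
  have h2 := (dx_contDiff hw).continuous
  have h3 := (dy_contDiff hf).continuous
  have h4 := (dy_contDiff hw).continuous
  fun_prop

lemma green {κ a : ℝ} (ha : 0 ≤ a) {c : ℝ → ℝ} (hc : ContDiff ℝ 2 c)
    (hca : ∀ x, a ≤ |x| → c x = 0) {w f : ℝ × ℝ → ℝ} (hw : ContDiff ℝ 2 w) (hf : ContDiff ℝ 2 f)
    (hwp : ∀ x y, w (x, y + 2 * π) = w (x, y)) (hfp : ∀ x y, f (x, y + 2 * π) = f (x, y)) :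
    ∫ p in box a, c p.1 * w p * lap κ f p =
      - (∫ p in box a, c p.1 * gdot κ w f p) - ∫ p in box a, deriv c p.1 * w p * dx f p := by
  have hc1 : ContDiff ℝ 1 c := hc.of_le (by norm_num)
  have hw1 : ContDiff ℝ 1 w := hw.of_le (by norm_num)
  have hcf : ContDiff ℝ 1 (fun p : ℝ × ℝ => c p.1) := hc1.comp contDiff_fst
  have hcw : ContDiff ℝ 1 (fun p : ℝ × ℝ => c p.1 * w p) := hcf.mul hw1
  have hfx := dx_contDiff hf
  have hfy := dy_contDiff hf
  have hF : ContDiff ℝ 1 (fun p : ℝ × ℝ => (c p.1 * w p) * dx f p) := hcw.mul hfx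
  have hcwk : ContDiff ℝ 1 (fun p : ℝ × ℝ => κ * (c p.1 * w p)) := contDiff_const.mul hcw
  have hH : ContDiff ℝ 1 (fun p : ℝ × ℝ => (c p.1 * w p) * (κ * dy f p)) :=
    hcw.mul (contDiff_const.mul hfy)
  have ca : c a = 0 := hca a (le_abs_self a)
  have cna : c (-a) = 0 := hca (-a) (by rw [abs_neg]; exact le_abs_self a)
  have key := divergence hF hH ha (fun y => by simp [ca]) (fun y => by simp [cna])
    (fun x => by
      have := hwp x 0
      simp only [zero_add] at this
      simp only [this, dy_per hfp])
  have hdc : Continuous (deriv c) := hc1.continuous_deriv (by norm_num)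
  have i1 : IntegrableOn (fun p : ℝ × ℝ => c p.1 * w p * lap κ f p) (box a) :=
    cont_int (hcw.continuous.mul (lap_cont hf)) a
  have i2 : IntegrableOn (fun p : ℝ × ℝ => c p.1 * gdot κ w f p) (box a) :=
    cont_int (hcf.continuous.mul (gdot_cont hw hf)) a
  have i3 : IntegrableOn (fun p : ℝ × ℝ => deriv c p.1 * w p * dx f p) (box a) :=
    cont_int (((hdc.comp continuous_fst).mul hw.continuous).mul hfx.continuous) a
  have e : ∀ p, dx (fun p : ℝ × ℝ => (c p.1 * w p) * dx f p) p
      + dy (fun p : ℝ × ℝ => (c p.1 * w p) * (κ * dy f p)) p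
      = c p.1 * w p * lap κ f p + (c p.1 * gdot κ w f p + deriv c p.1 * w p * dx f p) := by
    intro p
    rw [dx_mul hcw hfx, dy_mul hcw (contDiff_const.mul hfy), dx_mul hcf hw1, dy_mul hcf hw1,
      dx_fst hc1, dy_fst hc1, dy_mul contDiff_const hfy]
    have : dy (fun _ : ℝ × ℝ => κ) p = 0 := by unfold dy; simp
    rw [this]
    unfold lap gdot
    ring
  simp_rw [e] at key
  have i23 : IntegrableOn (fun p : ℝ × ℝ => c p.1 * gdot κ w f p + deriv c p.1 * w p * dx f p)
      (box a) := i2.add i3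
  rw [integral_add i1 i23, integral_add i2 i3] at key
  linarith

lemma green2 {κ a : ℝ} (ha : 0 ≤ a) {c : ℝ → ℝ} (hc : ContDiff ℝ 2 c)
    (hca : ∀ x, a ≤ |x| → c x = 0) (hca' : ∀ x, a ≤ |x| → deriv c x = 0)
    {f : ℝ × ℝ → ℝ} (hf : ContDiff ℝ 2 f)
    (hfp : ∀ x y, f (x, y + 2 * π) = f (x, y)) :
    ∫ p in box a, c p.1 * gdot κ f f p =
      - (∫ p in box a, c p.1 * f p * lap κ f p)
        + 1 / 2 * ∫ p in box a, deriv (deriv c) p.1 * f p ^ 2 := by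
  have hc' : ContDiff ℝ 1 (deriv c) := by
    have : ContDiff ℝ (1 + 1) c := hc.of_le (by norm_num)
    exact (contDiff_succ_iff_deriv.1 this).2.2
  have h1 := green (κ := κ) ha hc hca hf hf hfp hfp
  have hf1 : ContDiff ℝ 1 f := hf.of_le (by norm_num)
  have hcf : ContDiff ℝ 1 (fun p : ℝ × ℝ => deriv c p.1) := hc'.comp contDiff_fst
  have hF : ContDiff ℝ 1 (fun p : ℝ × ℝ => deriv c p.1 * (f p * f p)) := hcf.mul (hf1.mul hf1)
  have ca : deriv c a = 0 := hca' a (le_abs_self a)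
  have cna : deriv c (-a) = 0 := hca' (-a) (by rw [abs_neg]; exact le_abs_self a)
  have key := divergence (H := fun _ => 0) hF contDiff_const ha (fun y => by simp [ca])
    (fun y => by simp [cna]) (fun x => rfl)
  have hdc : Continuous (deriv (deriv c)) := hc'.continuous_deriv (by norm_num)
  have i3 : IntegrableOn (fun p : ℝ × ℝ => 2 * (deriv c p.1 * f p * dx f p)) (box a) :=
    cont_int (continuous_const.mul ((hcf.continuous.mul hf.continuous).mul (dx_cont hf1))) a
  have i4 : IntegrableOn (fun p : ℝ × ℝ => deriv (deriv c) p.1 * f p ^ 2) (box a) :=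
    cont_int ((hdc.comp continuous_fst).mul (hf.continuous.pow 2)) a
  have e : ∀ p, dx (fun p : ℝ × ℝ => deriv c p.1 * (f p * f p)) p + dy (fun _ => 0) p
      = 2 * (deriv c p.1 * f p * dx f p) + deriv (deriv c) p.1 * f p ^ 2 := by
    intro p
    rw [dx_mul hcf (hf1.mul hf1), dx_mul hf1 hf1, dx_fst hc']
    have : dy (fun _ : ℝ × ℝ => 0) p = 0 := by unfold dy; simp
    rw [this]; ring
  simp_rw [e] at key
  rw [integral_add i3 i4, integral_const_mul] at key
  linarith

end ConeLiouville

namespace ConeLiouville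

/-- bounded solutions on the cylinder, for times `t ≤ 0`; `g` is the time derivative of `f` -/
structure Sol (κ N : ℝ) (f g : ℝ → ℝ × ℝ → ℝ) : Prop where
  hd : ∀ t ≤ 0, ∀ p, HasDerivAt (fun s => f s p) (g t p) t
  gc : ∀ p, ContinuousOn (fun s => g s p) (Iic 0)
  sm : ∀ t ≤ 0, ContDiff ℝ 2 (f t)
  per : ∀ t ≤ 0, ∀ x y, f t (x, y + 2 * π) = f t (x, y)
  bd : ∀ t ≤ 0, ∀ p, |f t p| ≤ N
  pde : ∀ t ≤ 0, ∀ p, exp (2 * p.1) * g t p = lap κ (f t) p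
  int : ∀ a T, IntegrableOn (Function.uncurry g) (Icc (-T) 0 ×ˢ box a)

/-- cutoff data -/
structure Cut (a : ℝ) (c q : ℝ → ℝ) : Prop where
  ha : 0 ≤ a
  cd : ContDiff ℝ 2 c
  c0 : ∀ x, 0 ≤ c x
  supp : ∀ x, a ≤ |x| → c x = 0
  supp' : ∀ x, a ≤ |x| → deriv c x = 0
  qc : Continuous q
  q1 : ∀ x, |deriv (deriv c) x| ≤ q x
  q2 : ∀ x, deriv c x ^ 2 ≤ 2 * c x * q x

/-- weighted L2 norm -/
noncomputable def II (a : ℝ) (c : ℝ → ℝ) (F : ℝ × ℝ → ℝ) : ℝ :=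
  ∫ p in box a, c p.1 * exp (2 * p.1) * F p ^ 2
/-- weighted energy -/
noncomputable def GG (κ a : ℝ) (c : ℝ → ℝ) (F : ℝ × ℝ → ℝ) : ℝ :=
  ∫ p in box a, c p.1 * gdot κ F F p
/-- error term -/
noncomputable def QQ (a : ℝ) (q : ℝ → ℝ) (F : ℝ × ℝ → ℝ) : ℝ :=
  ∫ p in box a, q p.1 * F p ^ 2

lemma timeFTC {a t1 t2 : ℝ} (h12 : t1 ≤ t2) {H Ht : ℝ → ℝ × ℝ → ℝ}
    (hd : ∀ p, ∀ t ∈ Icc t1 t2, HasDerivAt (fun s => H s p) (Ht t p) t)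
    (hc : ∀ p, ContinuousOn (fun s => Ht s p) (Icc t1 t2))
    (hi : IntegrableOn (Function.uncurry Ht) (Icc t1 t2 ×ˢ box a))
    (h1 : IntegrableOn (H t1) (box a)) (h2 : IntegrableOn (H t2) (box a)) :
    IntervalIntegrable (fun t => ∫ p in box a, Ht t p) volume t1 t2 ∧
    (∫ p in box a, H t2 p) - (∫ p in box a, H t1 p) = ∫ t in t1..t2, ∫ p in box a, Ht t p := by
  have hi' : Integrable (Function.uncurry Ht)
      ((volume.restrict (Ioc t1 t2)).prod (volume.restrict (box a))) := by
    rw [Measure.prod_restrict]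
    exact hi.mono_set (prod_mono Ioc_subset_Icc_self le_rfl)
  constructor
  · rw [intervalIntegrable_iff_integrableOn_Ioc_of_le h12]
    exact hi'.integral_prod_left
  · rw [intervalIntegral.integral_of_le h12, integral_integral_swap hi', ← integral_sub h2 h1]
    refine integral_congr_ae (Filter.Eventually.of_forall fun p => ?_)
    simp only
    rw [← intervalIntegral.integral_of_le h12]
    rw [intervalIntegral.integral_eq_sub_of_hasDerivAt]
    · intro t ht
      rw [uIcc_of_le h12] at ht
      exact hd p t ht
    · apply ContinuousOn.intervalIntegrable
      rw [uIcc_of_le h12]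
      exact hc p

namespace Sol
variable {κ N : ℝ} {f g : ℝ → ℝ × ℝ → ℝ}

lemma fc (h : Sol κ N f g) (p : ℝ × ℝ) : ContinuousOn (fun s => f s p) (Iic 0) :=
  fun t ht => (h.hd t ht p).continuousAt.continuousWithinAt

lemma gcx (h : Sol κ N f g) {t : ℝ} (ht : t ≤ 0) : Continuous (g t) := by
  have : g t = fun p => exp (-(2 * p.1)) * lap κ (f t) p := by
    funext p
    rw [← h.pde t ht p, ← mul_assoc, ← exp_add]
    simp
  rw [this]
  have := lap_cont (κ := κ) (h.sm t ht)
  fun_prop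

lemma fmeas (h : Sol κ N f g) {t1 t2 : ℝ} (h2 : t2 ≤ 0) (a : ℝ) :
    AEStronglyMeasurable (Function.uncurry f) (volume.restrict (Icc t1 t2 ×ˢ box a)) := by
  have m : Measurable (Function.uncurry (fun t p => f (min t 0) p)) := by
    apply measurable_uncurry_of_continuous_of_measurable
    · intro p
      exact (h.fc p).comp_continuous (by fun_prop) (fun t => show min t 0 ≤ 0 from min_le_right _ _)
    · intro t
      exact (h.sm _ (min_le_right _ _)).continuous.measurable
  refine m.aestronglyMeasurable.congr ?_
  filter_upwards [ae_restrict_mem (measurableSet_Icc.prod (box_meas a))] with x hx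
  have : x.1 ≤ 0 := hx.1.2.trans h2
  simp [Function.uncurry, min_eq_left this]

lemma int_mul (h : Sol κ N f g) {t1 t2 : ℝ} (h2 : t2 ≤ 0) (a : ℝ) {w : ℝ → ℝ × ℝ → ℝ}
    {C : ℝ} (hw : AEStronglyMeasurable (Function.uncurry w) (volume.restrict (Icc t1 t2 ×ˢ box a)))
    (hb : ∀ t ∈ Icc t1 t2, ∀ p ∈ box a, |w t p| ≤ C) :
    IntegrableOn (Function.uncurry (fun t p => w t p * g t p)) (Icc t1 t2 ×ˢ box a) := by
  have hg : IntegrableOn (Function.uncurry g) (Icc t1 t2 ×ˢ box a) :=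
    (h.int a (-t1)).mono_set (prod_mono (by rw [neg_neg]; exact Icc_subset_Icc le_rfl h2) le_rfl)
  refine Integrable.bdd_mul hg hw (c := C) ?_
  filter_upwards [ae_restrict_mem (measurableSet_Icc.prod (box_meas a))] with x hx
  exact hb x.1 hx.1 x.2 hx.2

lemma sq_cont (h : Sol κ N f g) {W : ℝ × ℝ → ℝ} (hW : Continuous W) (a : ℝ) :
    ContinuousOn (fun t => ∫ p in box a, W p * f t p ^ 2) (Iic 0) := by
  refine continuousOn_of_dominated (bound := fun p => |W p| * N ^ 2) ?_ ?_ ?_ ?_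
  · intro t ht
    exact (hW.mul ((h.sm t ht).continuous.pow 2)).aestronglyMeasurable
  · intro t ht
    refine Filter.Eventually.of_forall fun p => ?_
    rw [norm_mul, norm_pow, norm_eq_abs, norm_eq_abs]
    gcongr
    exact h.bd t ht p
  · exact cont_int (by fun_prop) a
  · refine Filter.Eventually.of_forall fun p => ?_
    exact continuousOn_const.mul ((h.fc p).pow 2)

lemma sq_ii (h : Sol κ N f g) {W : ℝ × ℝ → ℝ} (hW : Continuous W) (a : ℝ) {t1 t2 : ℝ}
    (h12 : t1 ≤ t2) (h2 : t2 ≤ 0) :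
    IntervalIntegrable (fun t => ∫ p in box a, W p * f t p ^ 2) volume t1 t2 := by
  apply ContinuousOn.intervalIntegrable
  rw [uIcc_of_le h12]
  exact (h.sq_cont hW a).mono fun t ht => ht.2.trans h2

lemma II_ii (h : Sol κ N f g) {a : ℝ} {c q : ℝ → ℝ} (hc : Cut a c q) {t1 t2 : ℝ}
    (h12 : t1 ≤ t2) (h2 : t2 ≤ 0) :
    IntervalIntegrable (fun t => II a c (f t)) volume t1 t2 := by
  have := hc.cd.continuous
  exact h.sq_ii (W := fun p => c p.1 * exp (2 * p.1)) (by fun_prop) a h12 h2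

lemma QQ_ii (h : Sol κ N f g) {a : ℝ} {c q : ℝ → ℝ} (hc : Cut a c q) {t1 t2 : ℝ}
    (h12 : t1 ≤ t2) (h2 : t2 ≤ 0) :
    IntervalIntegrable (fun t => QQ a q (f t)) volume t1 t2 := by
  have := hc.qc
  exact h.sq_ii (W := fun p => q p.1) (by fun_prop) a h12 h2

end Sol

lemma Cut.cont2 {a : ℝ} {c q : ℝ → ℝ} (hc : Cut a c q) : Continuous (deriv (deriv c)) := by
  have : ContDiff ℝ (1 + 1) c := hc.cd.of_le (by norm_num)
  have h1 : ContDiff ℝ 1 (deriv c) := (contDiff_succ_iff_deriv.1 this).2.2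
  exact h1.continuous_deriv (by norm_num)

lemma Cut.q0 {a : ℝ} {c q : ℝ → ℝ} (hc : Cut a c q) (x : ℝ) : 0 ≤ q x :=
  (abs_nonneg _).trans (hc.q1 x)

lemma box_bdd {W : ℝ × ℝ → ℝ} (hW : Continuous W) (a : ℝ) : ∃ C, 0 ≤ C ∧ ∀ p ∈ box a, |W p| ≤ C := by
  obtain ⟨C, hC⟩ := (box_compact a).exists_bound_of_continuousOn hW.continuousOn
  exact ⟨max C 0, le_max_right _ _, fun p hp => (hC p hp).trans (le_max_left _ _)⟩

lemma GG_nonneg {κ a : ℝ} (hκ : 0 ≤ κ) {c : ℝ → ℝ} (hc : ∀ x, 0 ≤ c x) (F : ℝ × ℝ → ℝ) :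
    0 ≤ GG κ a c F := by
  unfold GG gdot
  refine integral_nonneg fun p => ?_
  have := hc p.1
  have h1 := mul_self_nonneg (dx F p)
  have h2 := mul_self_nonneg (dy F p)
  positivity

lemma II_nonneg {a : ℝ} {c : ℝ → ℝ} (hc : ∀ x, 0 ≤ c x) (F : ℝ × ℝ → ℝ) :
    0 ≤ II a c F := by
  unfold II
  refine integral_nonneg fun p => ?_
  have := hc p.1
  positivity

lemma QQ_nonneg {a : ℝ} {c q : ℝ → ℝ} (hc : Cut a c q) (F : ℝ × ℝ → ℝ) :
    0 ≤ QQ a q F := by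
  unfold QQ
  refine integral_nonneg fun p => ?_
  have := hc.q0 p.1
  positivity

/-- Caccioppoli inequality -/
lemma E1 {κ N : ℝ} {f g : ℝ → ℝ × ℝ → ℝ} (h : Sol κ N f g) {a : ℝ} {c q : ℝ → ℝ}
    (hc : Cut a c q) {t1 t2 : ℝ} (h12 : t1 ≤ t2) (h2 : t2 ≤ 0) :
    IntervalIntegrable (fun t => GG κ a c (f t)) volume t1 t2 ∧
    2 * (∫ t in t1..t2, GG κ a c (f t)) + II a c (f t2) ≤
      II a c (f t1) + ∫ t in t1..t2, QQ a q (f t) := by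
  have cc := hc.cd.continuous
  set W : ℝ × ℝ → ℝ := fun p => c p.1 * exp (2 * p.1) with hWdef
  have hW : Continuous W := by fun_prop
  obtain ⟨C, hC0, hC⟩ := box_bdd hW a
  have hN : 0 ≤ N := (abs_nonneg _).trans (h.bd 0 le_rfl 0)
  have hi := h.int_mul (t1 := t1) h2 a (w := fun t p => 2 * W p * f t p) (C := 2 * C * N)
    (by
      have m1 : AEStronglyMeasurable (fun x : ℝ × (ℝ × ℝ) => 2 * W x.2)
        (volume.restrict (Icc t1 t2 ×ˢ box a)) := by
        apply Continuous.aestronglyMeasurable; fun_prop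
      exact m1.mul (h.fmeas h2 a))
    (by
      intro t ht p hp
      rw [abs_mul, abs_mul, abs_two]
      gcongr
      · exact hC p hp
      · exact h.bd t (ht.2.trans h2) p)
  have key := timeFTC (H := fun t p => W p * f t p ^ 2) h12 (a := a)
    (by
      intro p t ht
      have := ((h.hd t (ht.2.trans h2) p).pow 2).const_mul (W p)
      refine this.congr_deriv ?_
      push_cast; ring)
    (by
      intro p
      have i1 := (h.fc p).mono (fun t (ht : t ∈ Icc t1 t2) => ht.2.trans h2)
      have i2 := (h.gc p).mono (fun t (ht : t ∈ Icc t1 t2) => ht.2.trans h2)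
      exact (continuousOn_const.mul i1).mul i2)
    hi
    (cont_int (hW.mul ((h.sm t1 (h12.trans h2)).continuous.pow 2)) a)
    (cont_int (hW.mul ((h.sm t2 h2).continuous.pow 2)) a)
  have i5 := h.sq_ii (W := fun p => deriv (deriv c) p.1) (hc.cont2.comp continuous_fst) a h12 h2
  have eG : ∀ t ≤ 0, GG κ a c (f t) = (-1 / 2) * (∫ p in box a, 2 * W p * f t p * g t p)
      + 1 / 2 * ∫ p in box a, deriv (deriv c) p.1 * f t p ^ 2 := by
    intro t ht
    unfold GG
    rw [green2 hc.ha hc.cd hc.supp hc.supp' (h.sm t ht) (h.per t ht), ← integral_const_mul (-1 / 2), ← integral_neg]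
    congr 1
    refine integral_congr_ae (Filter.Eventually.of_forall fun p => ?_)
    simp only [hWdef]
    rw [← h.pde t ht p]; ring
  have ii : IntervalIntegrable (fun t => (-1 / 2) * (∫ p in box a, 2 * W p * f t p * g t p)
      + 1 / 2 * ∫ p in box a, deriv (deriv c) p.1 * f t p ^ 2) volume t1 t2 :=
    (key.1.const_mul (-1/2)).add (i5.const_mul (1/2))
  have eI : ∫ t in t1..t2, GG κ a c (f t) =
      ∫ t in t1..t2, ((-1 / 2) * (∫ p in box a, 2 * W p * f t p * g t p)
      + 1 / 2 * ∫ p in box a, deriv (deriv c) p.1 * f t p ^ 2) := by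
    apply intervalIntegral.integral_congr
    intro t ht
    rw [uIcc_of_le h12] at ht
    exact eG t (ht.2.trans h2)
  constructor
  · refine ii.congr ?_
    intro t ht
    rw [uIoc_of_le h12] at ht
    exact (eG t (ht.2.trans h2)).symm
  · rw [eI, intervalIntegral.integral_add (key.1.const_mul (-1/2)) (i5.const_mul (1/2)),
      intervalIntegral.integral_const_mul,
      intervalIntegral.integral_const_mul, ← key.2]
    have le : ∫ t in t1..t2, (∫ p in box a, deriv (deriv c) p.1 * f t p ^ 2) ≤
        ∫ t in t1..t2, QQ a q (f t) := by
      apply intervalIntegral.integral_mono_on h12 i5 (h.QQ_ii hc h12 h2)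
      intro t ht
      have ft := (h.sm t (ht.2.trans h2)).continuous
      have := hc.qc
      have := hc.cont2
      unfold QQ
      apply setIntegral_mono (cont_int (by fun_prop) a) (cont_int (by fun_prop) a)
      intro p
      simp only
      gcongr
      exact (le_abs_self _).trans (hc.q1 _)
    unfold II
    linarith

end ConeLiouville

namespace ConeLiouville

lemma dx_sub {f g : ℝ × ℝ → ℝ} (hf : ContDiff ℝ 1 f) (hg : ContDiff ℝ 1 g) :
    dx (fun p => f p - g p) = fun p => dx f p - dx g p := by
  funext p
  have h1 := hf.differentiable (by norm_num) p
  have h2 := hg.differentiable (by norm_num) p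
  unfold dx
  rw [fderiv_fun_sub h1 h2]
  simp

lemma dy_sub {f g : ℝ × ℝ → ℝ} (hf : ContDiff ℝ 1 f) (hg : ContDiff ℝ 1 g) :
    dy (fun p => f p - g p) = fun p => dy f p - dy g p := by
  funext p
  have h1 := hf.differentiable (by norm_num) p
  have h2 := hg.differentiable (by norm_num) p
  unfold dy
  rw [fderiv_fun_sub h1 h2]
  simp

lemma lap_sub {κ : ℝ} {f g : ℝ × ℝ → ℝ} (hf : ContDiff ℝ 2 f) (hg : ContDiff ℝ 2 g) (p : ℝ × ℝ) :
    lap κ (fun p => f p - g p) p = lap κ f p - lap κ g p := by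
  unfold lap
  rw [dx_sub (hf.of_le (by norm_num)) (hg.of_le (by norm_num)),
    dy_sub (hf.of_le (by norm_num)) (hg.of_le (by norm_num)),
    dx_sub (dx_contDiff hf) (dx_contDiff hg), dy_sub (dy_contDiff hf) (dy_contDiff hg)]
  ring

lemma Sol.diff {κ N : ℝ} {f g : ℝ → ℝ × ℝ → ℝ} (h : Sol κ N f g) {s : ℝ} (hs : 0 ≤ s) :
    Sol κ (2 * N) (fun t p => f (t - s) p - f t p) (fun t p => g (t - s) p - g t p) where
  hd := by
    intro t ht p
    have h1 := (h.hd (t - s) (by linarith) p)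
    have h2 : HasDerivAt (fun r => f (r - s) p) (g (t - s) p) t := by
      simpa using h1.comp_sub_const t s
    exact h2.sub (h.hd t ht p)
  gc := by
    intro p
    refine ContinuousOn.sub ?_ (h.gc p)
    exact (h.gc p).comp (f := fun t => t - s) (by fun_prop) (fun t (ht : t ≤ 0) => show t - s ≤ 0 by linarith)
  sm := by
    intro t ht
    exact (h.sm (t - s) (by linarith)).sub (h.sm t ht)
  per := by
    intro t ht x y
    rw [h.per (t - s) (by linarith), h.per t ht]
  bd := by
    intro t ht p
    have h1 := h.bd (t - s) (by linarith) p
    have h2 := h.bd t ht p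
    have := abs_sub (f (t - s) p) (f t p)
    linarith
  pde := by
    intro t ht p
    rw [lap_sub (h.sm (t - s) (by linarith)) (h.sm t ht), ← h.pde (t - s) (by linarith), ← h.pde t ht]
    ring
  int := by
    intro a T
    have h1 := h.int a T
    have h2 := h.int a (T + s)
    have mp : MeasurePreserving (Prod.map (fun t : ℝ => t - s) (id : ℝ × ℝ → ℝ × ℝ)) volume volume :=
      (measurePreserving_sub_right volume s).prod (MeasurePreserving.id volume)
    have me : MeasurableEmbedding (Prod.map (fun t : ℝ => t - s) (id : ℝ × ℝ → ℝ × ℝ)) :=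
      (measurableEmbedding_subRight s).prodMap MeasurableEmbedding.id
    have h3 := (mp.integrableOn_comp_preimage me (s := Icc (-(T + s)) 0 ×ˢ box a)).2 h2
    have h4 : IntegrableOn (fun x : ℝ × (ℝ × ℝ) => g (x.1 - s) x.2) (Icc (-T) 0 ×ˢ box a) := by
      have h5 := h3.mono_set (s := Icc (-T) 0 ×ˢ box a) (by
        rintro ⟨t, p⟩ ⟨ht, hp⟩
        simp only [mem_Icc] at ht
        refine ⟨?_, ?_⟩
        · simp only [mem_Icc, Prod.map]; constructor <;> linarith
        · simpa using hp)
      refine h5.congr_fun ?_ (measurableSet_Icc.prod (box_meas a))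
      intro x hx
      simp [Function.uncurry, Prod.map]
    exact h4.sub h1

lemma avg_swap {G : ℝ → ℝ} {t1 t2 s : ℝ} (h12 : t1 ≤ t2) (hs : 0 ≤ s)
    (hG0 : ∀ t ≤ t2, 0 ≤ G t) (hG : IntervalIntegrable G volume (t1 - s) t2) :
    IntervalIntegrable (fun t => ∫ r in (t - s)..t, G r) volume t1 t2 ∧
    ∫ t in t1..t2, ∫ r in (t - s)..t, G r ≤ s * ∫ r in (t1 - s)..t2, G r := by
  have h13 : t1 - s ≤ t2 := by linarith
  set G' : ℝ → ℝ := indicator (Ioc (t1 - s) t2) G with hG'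
  have hI : Integrable G' := by
    rw [integrable_indicator_iff measurableSet_Ioc]
    exact (intervalIntegrable_iff_integrableOn_Ioc_of_le h13).1 hG
  have hii : ∀ x y, IntervalIntegrable G' volume x y := fun x y => hI.intervalIntegrable
  have h0 : ∀ t, 0 ≤ G' t := by
    intro t
    apply indicator_nonneg
    intro x hx
    exact hG0 x hx.2
  set H : ℝ → ℝ := fun t => ∫ r in (t1 - s)..t, G' r with hH
  have hHc : Continuous H := intervalIntegral.continuous_primitive hii _
  have hmono : Monotone H := by
    intro x y hxy
    have : H y - H x = ∫ r in x..y, G' r := by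
      simp only [hH]
      rw [intervalIntegral.integral_interval_sub_left (hii _ _) (hii _ _)]
    have h1 : 0 ≤ ∫ r in x..y, G' r := intervalIntegral.integral_nonneg hxy fun r _ => h0 r
    linarith
  have e1 : ∀ x y, t1 - s ≤ x → x ≤ y → y ≤ t2 → ∫ r in x..y, G r = ∫ r in x..y, G' r := by
    intro x y hx hxy hy
    apply intervalIntegral.integral_congr_ae
    refine Filter.Eventually.of_forall fun r hr => ?_
    rw [uIoc_of_le hxy] at hr
    rw [hG', indicator_of_mem]
    exact ⟨lt_of_le_of_lt hx hr.1, hr.2.trans hy⟩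
  have e2 : ∀ t ∈ Icc t1 t2, ∫ r in (t - s)..t, G r = H t - H (t - s) := by
    intro t ht
    rw [e1 _ _ (by linarith [ht.1]) (by linarith) ht.2]
    simp only [hH]
    rw [intervalIntegral.integral_interval_sub_left (hii _ _) (hii _ _)]
  have hHi : ∀ x y, IntervalIntegrable H volume x y := fun x y => hHc.intervalIntegrable x y
  have hHs : Continuous fun t => H (t - s) := by fun_prop
  constructor
  · refine IntervalIntegrable.congr (f := fun t => H t - H (t - s)) ?_
      ((hHc.sub hHs).intervalIntegrable _ _)
    intro t ht
    rw [uIoc_of_le h12] at ht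
    exact (e2 t ⟨ht.1.le, ht.2⟩).symm
  · have e3 : ∫ t in t1..t2, ∫ r in (t - s)..t, G r = ∫ t in t1..t2, (H t - H (t - s)) := by
      apply intervalIntegral.integral_congr
      intro t ht
      rw [uIcc_of_le h12] at ht
      exact e2 t ht
    rw [e3, intervalIntegral.integral_sub (hHi _ _) (hHs.intervalIntegrable _ _),
      intervalIntegral.integral_comp_sub_right (fun t => H t) s,
      intervalIntegral.integral_interval_sub_interval_comm (hHi _ _) (hHi _ _) (hHi _ _),
      e1 _ _ le_rfl h13 le_rfl]
    have n1 : 0 ≤ ∫ t in (t1 - s)..t1, H t := by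
      apply intervalIntegral.integral_nonneg (by linarith)
      intro t ht
      exact intervalIntegral.integral_nonneg ht.1 fun r _ => h0 r
    have n2 : ∫ t in (t2 - s)..t2, H t ≤ ∫ t in (t2 - s)..t2, H t2 := by
      apply intervalIntegral.integral_mono_on (by linarith) (hHi _ _) (by simp)
      intro t ht
      exact hmono ht.2
    simp only [intervalIntegral.integral_const, smul_eq_mul] at n2
    have n3 : (t2 - (t2 - s)) * H t2 = s * H t2 := by ring
    rw [n3] at n2
    have n4 : ∫ t in t1..(t1 - s), H t = - ∫ t in (t1 - s)..t1, H t :=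
      intervalIntegral.integral_symm _ _
    have n5 : ∫ t in t2..(t2 - s), H t = - ∫ t in (t2 - s)..t2, H t :=
      intervalIntegral.integral_symm _ _
    change _ ≤ s * H t2
    linarith

lemma gdot_self_nonneg {κ : ℝ} (hκ : 0 ≤ κ) (F : ℝ × ℝ → ℝ) (p : ℝ × ℝ) : 0 ≤ gdot κ F F p := by
  unfold gdot
  have h1 := mul_self_nonneg (dx F p)
  have h2 := mul_self_nonneg (dy F p)
  positivity

lemma E2_point {κ : ℝ} (hκ : 0 ≤ κ) {c c' q w wx wy fx fy l : ℝ} (hl : 0 < l) (hc : 0 ≤ c)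
    (hq : 0 ≤ q) (h : c' ^ 2 ≤ 2 * c * q) :
    c * (wx * fx + κ * (wy * fy)) + c' * w * fx ≤
      l * (1 / 2 * (c * (wx * wx + κ * (wy * wy))) + q * w ^ 2)
       + l⁻¹ * (c * (fx * fx + κ * (fy * fy))) := by
  have am : ∀ x y : ℝ, x * y ≤ l * (1 / 2 * (x * x)) + l⁻¹ * (1 / 2 * (y * y)) := by
    intro x y
    have : 0 ≤ (l * x - y) ^ 2 * (l⁻¹ / 2) := by positivity
    have e : (l * x - y) ^ 2 * (l⁻¹ / 2) = l * (1 / 2 * (x * x)) + l⁻¹ * (1 / 2 * (y * y)) - x * y := by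
      field_simp; ring
    linarith
  have a1 := mul_le_mul_of_nonneg_left (am wx fx) hc
  have a2 := mul_le_mul_of_nonneg_left (am wy fy) (mul_nonneg hc hκ)
  have a3 : c' * w * fx ≤ l * (q * w ^ 2) + l⁻¹ * (1 / 2 * (c * (fx * fx))) := by
    have hA : 0 ≤ l * (q * w ^ 2) := by positivity
    have hB : 0 ≤ l⁻¹ * (1 / 2 * (c * (fx * fx))) := by
      have := mul_self_nonneg fx
      positivity
    refine (le_abs_self _).trans (abs_le_of_sq_le_sq ?_ (add_nonneg hA hB))
    have e1 : l * (q * w ^ 2) * (l⁻¹ * (1 / 2 * (c * (fx * fx)))) = 1 / 2 * (c * q) * (w * fx) ^ 2 := by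
      field_simp
    have e2 : (c' * w * fx) ^ 2 ≤ 2 * c * q * (w * fx) ^ 2 := by
      have : (c' * w * fx) ^ 2 = c' ^ 2 * (w * fx) ^ 2 := by ring
      rw [this]
      gcongr
    nlinarith [sq_nonneg (l * (q * w ^ 2) - l⁻¹ * (1 / 2 * (c * (fx * fx))))]
  have a4 : 0 ≤ l⁻¹ * (c * (κ * (fy * fy))) := by
    have := mul_self_nonneg fy
    positivity
  nlinarith

end ConeLiouville

namespace ConeLiouville

lemma E2_static {κ : ℝ} (hκ : 0 ≤ κ) {a : ℝ} {c q : ℝ → ℝ} (hc : Cut a c q)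
    {w f : ℝ × ℝ → ℝ} (hw : ContDiff ℝ 2 w) (hf : ContDiff ℝ 2 f)
    (hwp : ∀ x y, w (x, y + 2 * π) = w (x, y)) (hfp : ∀ x y, f (x, y + 2 * π) = f (x, y))
    {l : ℝ} (hl : 0 < l) :
    - ∫ p in box a, c p.1 * w p * lap κ f p ≤
      l * (1 / 2 * GG κ a c w + QQ a q w) + l⁻¹ * GG κ a c f := by
  have cc := hc.cd.continuous
  have qc := hc.qc
  have c'c : Continuous (deriv c) := hc.cd.continuous_deriv (by norm_num)
  have wc := hw.continuous
  have fxc := (dx_contDiff hf).continuous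
  have g1 := gdot_cont (κ := κ) hw hf
  have g2 := gdot_cont (κ := κ) hw hw
  have g3 := gdot_cont (κ := κ) hf hf
  rw [green hc.ha hc.cd hc.supp hw hf hwp hfp]
  have i1 : IntegrableOn (fun p : ℝ × ℝ => c p.1 * gdot κ w f p) (box a) :=
    cont_int (by fun_prop) a
  have i2 : IntegrableOn (fun p : ℝ × ℝ => deriv c p.1 * w p * dx f p) (box a) :=
    cont_int (by fun_prop) a
  have i3 : IntegrableOn (fun p : ℝ × ℝ => 1 / 2 * (c p.1 * gdot κ w w p)) (box a) :=
    cont_int (by fun_prop) a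
  have i4 : IntegrableOn (fun p : ℝ × ℝ => q p.1 * w p ^ 2) (box a) :=
    cont_int (by fun_prop) a
  have i5 : IntegrableOn (fun p : ℝ × ℝ => l⁻¹ * (c p.1 * gdot κ f f p)) (box a) :=
    cont_int (by fun_prop) a
  have i6 : IntegrableOn (fun p : ℝ × ℝ => l * (1 / 2 * (c p.1 * gdot κ w w p) + q p.1 * w p ^ 2))
    (box a) := cont_int (by fun_prop) a
  have e : l * (1 / 2 * GG κ a c w + QQ a q w) + l⁻¹ * GG κ a c f =
      ∫ p in box a, (l * (1 / 2 * (c p.1 * gdot κ w w p) + q p.1 * w p ^ 2)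
        + l⁻¹ * (c p.1 * gdot κ f f p)) := by
    rw [integral_add i6 i5, integral_const_mul, integral_const_mul, integral_add i3 i4,
      integral_const_mul]
    rfl
  rw [e]
  have e2 : -((-∫ p in box a, c p.1 * gdot κ w f p) - ∫ p in box a, deriv c p.1 * w p * dx f p) =
      ∫ p in box a, (c p.1 * gdot κ w f p + deriv c p.1 * w p * dx f p) := by
    rw [integral_add i1 i2]; ring
  rw [e2]
  apply setIntegral_mono (i1.add i2) (i6.add i5)
  intro p
  exact E2_point hκ hl (hc.c0 _) (hc.q0 _) (hc.q2 _)

lemma E2_t {κ N : ℝ} (hκ : 0 ≤ κ) {f g : ℝ → ℝ × ℝ → ℝ} (h : Sol κ N f g) {s : ℝ} (hs : 0 ≤ s)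
    {a : ℝ} {c q : ℝ → ℝ} (hc : Cut a c q) {l : ℝ} (hl : 0 < l) {t : ℝ} (ht : t ≤ 0) :
    II a c (fun p => f (t - s) p - f t p) ≤
      s * (l * (1 / 2 * GG κ a c (fun p => f (t - s) p - f t p)
        + QQ a q (fun p => f (t - s) p - f t p)))
      + l⁻¹ * ∫ r in (t - s)..t, GG κ a c (f r) := by
  have hv := h.diff hs
  set w : ℝ × ℝ → ℝ := fun p => f (t - s) p - f t p with hw
  have hwc : ContDiff ℝ 2 w := hv.sm t ht
  have wc := hwc.continuous
  have cc := hc.cd.continuous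
  set W : ℝ × ℝ → ℝ := fun p => c p.1 * exp (2 * p.1) * w p with hWdef
  have hW : Continuous W := by fun_prop
  obtain ⟨C, hC0, hC⟩ := box_bdd hW a
  have hst : t - s ≤ t := by linarith
  have hi := h.int_mul (t1 := t - s) ht a (w := fun _ p => W p) (C := C)
    (by
      apply Continuous.aestronglyMeasurable
      simp only [Function.uncurry_def]; fun_prop)
    (fun r hr p hp => hC p hp)
  have key := timeFTC (H := fun r p => W p * f r p) hst (a := a)
    (fun p r hr => (h.hd r (hr.2.trans ht) p).const_mul (W p))
    (fun p => continuousOn_const.mul ((h.gc p).mono (fun r (hr : r ∈ Icc (t - s) t) => hr.2.trans ht)))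
    hi
    (cont_int (hW.mul (h.sm (t - s) (by linarith)).continuous) a)
    (cont_int (hW.mul (h.sm t ht).continuous) a)
  have eI : II a c w = (∫ p in box a, W p * f (t - s) p) - ∫ p in box a, W p * f t p := by
    have j1 : IntegrableOn (fun p => W p * f (t - s) p) (box a) :=
      cont_int (hW.mul (h.sm (t - s) (by linarith)).continuous) a
    have j2 : IntegrableOn (fun p => W p * f t p) (box a) :=
      cont_int (hW.mul (h.sm t ht).continuous) a
    rw [← integral_sub j1 j2]
    unfold II
    refine integral_congr_ae (Filter.Eventually.of_forall fun p => ?_)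
    simp only [hWdef, hw]; ring
  have eI2 : II a c w = ∫ r in (t - s)..t, - ∫ p in box a, W p * g r p := by
    rw [intervalIntegral.integral_neg, ← key.2, eI]; ring
  have iG := (E1 h hc hst ht).1
  have e3 : s * (l * (1 / 2 * GG κ a c w + QQ a q w)) + l⁻¹ * ∫ r in (t - s)..t, GG κ a c (f r)
      = ∫ r in (t - s)..t, (l * (1 / 2 * GG κ a c w + QQ a q w) + l⁻¹ * GG κ a c (f r)) := by
    rw [intervalIntegral.integral_add (by simp) (iG.const_mul _),
      intervalIntegral.integral_const_mul l⁻¹, intervalIntegral.integral_const, smul_eq_mul]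
    ring
  rw [eI2, e3]
  apply intervalIntegral.integral_mono_on hst key.1.neg ((by simp : IntervalIntegrable
    (fun _ : ℝ => l * (1 / 2 * GG κ a c w + QQ a q w)) volume (t - s) t).add (iG.const_mul _))
  intro r hr
  have hr0 : r ≤ 0 := hr.2.trans ht
  have := E2_static hκ hc hwc (h.sm r hr0) (hv.per t ht) (h.per r hr0) hl
  refine le_trans (le_of_eq ?_) this
  congr 1
  refine integral_congr_ae (Filter.Eventually.of_forall fun p => ?_)
  simp only [hWdef]
  rw [← h.pde r hr0 p]; ring

lemma E2 {κ N : ℝ} (hκ : 0 ≤ κ) {f g : ℝ → ℝ × ℝ → ℝ} (h : Sol κ N f g) {s : ℝ} (hs : 0 ≤ s)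
    {a : ℝ} {c q : ℝ → ℝ} (hc : Cut a c q) {l : ℝ} (hl : 0 < l) {t1 t2 : ℝ} (h12 : t1 ≤ t2)
    (h2 : t2 ≤ 0) :
    ∫ t in t1..t2, II a c (fun p => f (t - s) p - f t p) ≤
      s * (l * (1 / 2 * (∫ t in t1..t2, GG κ a c (fun p => f (t - s) p - f t p))
        + ∫ t in t1..t2, QQ a q (fun p => f (t - s) p - f t p)))
      + l⁻¹ * (s * ∫ r in (t1 - s)..t2, GG κ a c (f r)) := by
  have hv := h.diff hs
  have iG := (E1 hv hc h12 h2).1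
  have iQ := hv.QQ_ii hc h12 h2
  have iI := hv.II_ii hc h12 h2
  have sw := avg_swap h12 hs (fun t _ => GG_nonneg hκ hc.c0 (f t))
    (E1 h hc (t1 := t1 - s) (by linarith) h2).1
  have i1 := ((((iG.const_mul (1 / 2)).add iQ).const_mul l).const_mul s)
  have i2 := sw.1.const_mul l⁻¹
  calc _ ≤ ∫ t in t1..t2, (s * (l * (1 / 2 * GG κ a c (fun p => f (t - s) p - f t p)
        + QQ a q (fun p => f (t - s) p - f t p)))
      + l⁻¹ * ∫ r in (t - s)..t, GG κ a c (f r)) := by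
        apply intervalIntegral.integral_mono_on h12 iI (i1.add i2)
        intro t ht
        exact E2_t hκ h hs hc hl (ht.2.trans h2)
    _ = s * (l * (1 / 2 * (∫ t in t1..t2, GG κ a c (fun p => f (t - s) p - f t p))
        + ∫ t in t1..t2, QQ a q (fun p => f (t - s) p - f t p)))
        + l⁻¹ * ∫ t in t1..t2, ∫ r in (t - s)..t, GG κ a c (f r) := by
        rw [← intervalIntegral.integral_const_mul (1 / 2), ← intervalIntegral.integral_const_mul l⁻¹,
          ← intervalIntegral.integral_add (iG.const_mul (1 / 2)) iQ,
          ← intervalIntegral.integral_const_mul l, ← intervalIntegral.integral_const_mul s]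
        exact intervalIntegral.integral_add i1 i2
    _ ≤ _ := by
        gcongr
        exact sw.2

lemma E1' {κ N : ℝ} (hκ : 0 ≤ κ) {f g : ℝ → ℝ × ℝ → ℝ} (h : Sol κ N f g) {a : ℝ} {c q : ℝ → ℝ}
    (hc : Cut a c q) {b T : ℝ} (hb : 0 ≤ b) (hT : 0 ≤ T) :
    T * (2 * ∫ t in (-b)..0, GG κ a c (f t)) ≤
      (∫ t in (-b - T)..(-b), II a c (f t)) + T * ∫ t in (-b - T)..0, QQ a q (f t) := by
  have h12 : -b - T ≤ -b := by linarith
  have hb0 : -b ≤ 0 := by linarith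
  have iI := h.II_ii hc h12 hb0
  have e1 : T * (2 * ∫ t in (-b)..0, GG κ a c (f t)) =
      ∫ t in (-b - T)..(-b), (2 * ∫ t in (-b)..0, GG κ a c (f t)) := by
    rw [intervalIntegral.integral_const, smul_eq_mul]; ring
  have e2 : (∫ t in (-b - T)..(-b), II a c (f t)) + T * ∫ t in (-b - T)..0, QQ a q (f t) =
      ∫ t in (-b - T)..(-b), (II a c (f t) + ∫ t in (-b - T)..0, QQ a q (f t)) := by
    rw [intervalIntegral.integral_add iI (by simp), intervalIntegral.integral_const, smul_eq_mul]
    ring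
  rw [e1, e2]
  apply intervalIntegral.integral_mono_on h12 (by simp) (iI.add (by simp))
  intro t ht
  have k := E1 h hc (ht.2.trans hb0) le_rfl
  have n1 := II_nonneg (a := a) hc.c0 (f 0)
  have m1 : ∫ r in (-b)..0, GG κ a c (f r) ≤ ∫ r in t..0, GG κ a c (f r) := by
    apply intervalIntegral.integral_mono_interval ht.2 hb0 le_rfl
      (Filter.Eventually.of_forall fun r => GG_nonneg hκ hc.c0 (f r)) k.1
  have m2 : ∫ r in t..0, QQ a q (f r) ≤ ∫ r in (-b - T)..0, QQ a q (f r) := by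
    apply intervalIntegral.integral_mono_interval ht.1 (ht.2.trans hb0) le_rfl
      (Filter.Eventually.of_forall fun r => QQ_nonneg hc (f r)) (h.QQ_ii hc (by linarith) le_rfl)
  linarith [k.2]

end ConeLiouville

namespace ConeLiouville

/-- error weight associated with a cutoff -/
noncomputable def qof (φ : ℝ → ℝ) (x : ℝ) : ℝ := 2 * deriv φ x ^ 2 + 2 * |φ x * deriv (deriv φ) x|

lemma cut_of {φ : ℝ → ℝ} (hφ : ContDiff ℝ 2 φ) {a : ℝ} (ha : 0 ≤ a)
    (hs : ∀ x, a ≤ |x| → φ x = 0) : Cut a (fun x => φ x ^ 2) (qof φ) := by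
  have hφ' : ContDiff ℝ 1 (deriv φ) := by
    have : ContDiff ℝ (1 + 1) φ := hφ.of_le (by norm_num)
    exact (contDiff_succ_iff_deriv.1 this).2.2
  have d1 : ∀ x, HasDerivAt φ (deriv φ x) x := fun x => (hφ.differentiable (by norm_num) x).hasDerivAt
  have d2 : ∀ x, HasDerivAt (deriv φ) (deriv (deriv φ) x) x :=
    fun x => (hφ'.differentiable (by norm_num) x).hasDerivAt
  have e1 : deriv (fun x => φ x ^ 2) = fun x => 2 * (φ x * deriv φ x) := by
    funext x
    have h : HasDerivAt (fun x => φ x ^ 2) (2 * (φ x * deriv φ x)) x :=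
      ((d1 x).pow 2).congr_deriv (by push_cast; ring)
    exact h.deriv
  have e2 : deriv (deriv (fun x => φ x ^ 2)) =
      fun x => 2 * (deriv φ x * deriv φ x + φ x * deriv (deriv φ) x) := by
    rw [e1]
    funext x
    exact (((d1 x).mul (d2 x)).const_mul 2).deriv
  refine ⟨ha, hφ.pow 2, fun x => sq_nonneg _, fun x hx => by simp [hs x hx],
    fun x hx => by simp [e1, hs x hx], ?_, ?_, ?_⟩
  · have c1 := hφ.continuous
    have c2 := hφ'.continuous
    have c3 : Continuous (deriv (deriv φ)) := hφ'.continuous_deriv (by norm_num)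
    unfold qof
    fun_prop
  · intro x
    rw [e2]
    unfold qof
    have := neg_abs_le (φ x * deriv (deriv φ) x)
    have := le_abs_self (φ x * deriv (deriv φ) x)
    have := sq_nonneg (deriv φ x)
    rw [abs_le]
    constructor <;> simp only <;> nlinarith
  · intro x
    rw [e1]
    unfold qof
    have h1 : 0 ≤ |φ x * deriv (deriv φ) x| := abs_nonneg _
    have h2 := mul_nonneg (sq_nonneg (φ x)) h1
    simp only
    nlinarith

lemma smoothT_bounds : ∃ K : ℝ, 0 ≤ K ∧ (∀ x, |deriv smoothTransition x| ≤ K) ∧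
    (∀ x, |deriv (deriv smoothTransition) x| ≤ K) ∧
    (∀ x, x ∉ Icc (0:ℝ) 1 → deriv smoothTransition x = 0) ∧
    (∀ x, x ∉ Icc (0:ℝ) 1 → deriv (deriv smoothTransition) x = 0) := by
  have hS : ContDiff ℝ 2 smoothTransition := Real.smoothTransition.contDiff (n := 2)
  have hS' : ContDiff ℝ 1 (deriv smoothTransition) := by
    have : ContDiff ℝ (1 + 1) smoothTransition := hS.of_le (by norm_num)
    exact (contDiff_succ_iff_deriv.1 this).2.2
  have z1 : ∀ x, x ∉ Icc (0:ℝ) 1 → deriv smoothTransition x = 0 := by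
    intro x hx
    by_cases h : x < 0
    · have : smoothTransition =ᶠ[nhds x] fun _ => 0 := by
        filter_upwards [gt_mem_nhds h] with y hy
        exact smoothTransition.zero_of_nonpos hy.le
      rw [this.deriv_eq]; simp
    · have h1 : 1 < x := by
        by_contra h2
        exact hx ⟨not_lt.1 h, not_lt.1 h2⟩
      have : smoothTransition =ᶠ[nhds x] fun _ => 1 := by
        filter_upwards [lt_mem_nhds h1] with y hy
        exact smoothTransition.one_of_one_le hy.le
      rw [this.deriv_eq]; simp
  have z2 : ∀ x, x ∉ Icc (0:ℝ) 1 → deriv (deriv smoothTransition) x = 0 := by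
    intro x hx
    have : deriv smoothTransition =ᶠ[nhds x] fun _ => 0 := by
      filter_upwards [isClosed_Icc.isOpen_compl.mem_nhds hx] with y hy
      exact z1 y hy
    rw [this.deriv_eq]; simp
  obtain ⟨K1, h1⟩ := isCompact_Icc.exists_bound_of_continuousOn (s := Icc (0:ℝ) 1)
    hS'.continuous.continuousOn
  obtain ⟨K2, h2⟩ := isCompact_Icc.exists_bound_of_continuousOn (s := Icc (0:ℝ) 1)
    (hS'.continuous_deriv (by norm_num)).continuousOn
  refine ⟨max (max K1 K2) 0, le_max_right _ _, ?_, ?_, z1, z2⟩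
  · intro x
    by_cases hx : x ∈ Icc (0:ℝ) 1
    · exact (h1 x hx).trans ((le_max_left _ _).trans (le_max_left _ _))
    · rw [z1 x hx]; simp
  · intro x
    by_cases hx : x ∈ Icc (0:ℝ) 1
    · exact (h2 x hx).trans ((le_max_right _ _).trans (le_max_left _ _))
    · rw [z2 x hx]; simp

/-- the cutoff, equal to one on `[-L, X]` and vanishing outside `[-2L, X+l]` -/
noncomputable def cutf (L X l x : ℝ) : ℝ :=
  smoothTransition (x / L + 2) * smoothTransition ((X - x) / l + 1)

lemma cutf_cd (L X l : ℝ) : ContDiff ℝ 2 (cutf L X l) := by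
  have hS : ContDiff ℝ 2 smoothTransition := Real.smoothTransition.contDiff (n := 2)
  unfold cutf
  refine (hS.comp (g := smoothTransition) (f := fun x : ℝ => x / L + 2) ?_).mul
    (hS.comp (g := smoothTransition) (f := fun x : ℝ => (X - x) / l + 1) ?_) <;> fun_prop

lemma cutf_nonneg (L X l x : ℝ) : 0 ≤ cutf L X l x :=
  mul_nonneg (smoothTransition.nonneg _) (smoothTransition.nonneg _)

lemma cutf_le_one (L X l x : ℝ) : cutf L X l x ≤ 1 :=
  mul_le_one₀ (smoothTransition.le_one _) (smoothTransition.nonneg _) (smoothTransition.le_one _)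

lemma cutf_eq_one {L X l x : ℝ} (hL : 0 < L) (hl : 0 < l) (h1 : -L ≤ x) (h2 : x ≤ X) :
    cutf L X l x = 1 := by
  unfold cutf
  rw [smoothTransition.one_of_one_le, smoothTransition.one_of_one_le, mul_one]
  · have : 0 ≤ (X - x) / l := div_nonneg (by linarith) hl.le
    linarith
  · have : -1 ≤ x / L := by rw [le_div_iff₀ hL]; linarith
    linarith

lemma cutf_zero_right {L X l x : ℝ} (hl : 0 < l) (h : X + l ≤ x) : cutf L X l x = 0 := by
  unfold cutf
  rw [smoothTransition.zero_of_nonpos (x := (X - x) / l + 1), mul_zero]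
  have : (X - x) / l ≤ -1 := by rw [div_le_iff₀ hl]; linarith
  linarith

lemma cutf_zero_left {L X l x : ℝ} (hL : 0 < L) (h : x ≤ -(2 * L)) : cutf L X l x = 0 := by
  unfold cutf
  rw [smoothTransition.zero_of_nonpos (x := x / L + 2), zero_mul]
  have : x / L ≤ -2 := by rw [div_le_iff₀ hL]; linarith
  linarith

lemma cutf_zero {L X l x a : ℝ} (hL : 0 < L) (hl : 0 < l) (h1 : 2 * L ≤ a) (h2 : X + l ≤ a)
    (hx : a ≤ |x|) : cutf L X l x = 0 := by
  rcases le_abs.1 hx with h | h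
  · exact cutf_zero_right hl (by linarith)
  · exact cutf_zero_left hL (by linarith)

lemma cutf_cut {L X l a : ℝ} (hL : 0 < L) (hl : 0 < l) (h1 : 2 * L ≤ a) (h2 : X + l ≤ a) :
    Cut a (fun x => cutf L X l x ^ 2) (qof (cutf L X l)) :=
  cut_of (cutf_cd L X l) (by linarith) fun _ hx => cutf_zero hL hl h1 h2 hx

lemma cutf_mono {L X Y l x : ℝ} (hl : 0 < l) (h : X ≤ Y) : cutf L X l x ≤ cutf L Y l x := by
  unfold cutf
  gcongr
  · exact smoothTransition.nonneg _
  · exact smoothTransition.monotone (by gcongr)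

lemma q_bound : ∃ C : ℝ, 0 ≤ C ∧ ∀ L X l x : ℝ, 0 < L → 0 ≤ X → 0 < l →
    qof (cutf L X l) x ≤ C * ((L ^ 2)⁻¹ * indicator (Icc (-(2 * L)) (-L)) 1 x
      + (l ^ 2)⁻¹ * indicator (Icc X (X + l)) 1 x) := by
  obtain ⟨K, hK, k1, k2, z1, z2⟩ := smoothT_bounds
  refine ⟨2 * K ^ 2 + 2 * K, by positivity, ?_⟩
  intro L X l x hL hX hl
  have hS : ContDiff ℝ 2 smoothTransition := Real.smoothTransition.contDiff (n := 2)
  have hS' : ContDiff ℝ 1 (deriv smoothTransition) := by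
    have : ContDiff ℝ (1 + 1) smoothTransition := hS.of_le (by norm_num)
    exact (contDiff_succ_iff_deriv.1 this).2.2
  have d1 : ∀ y, HasDerivAt smoothTransition (deriv smoothTransition y) y :=
    fun y => (hS.differentiable (by norm_num) y).hasDerivAt
  have d2 : ∀ y, HasDerivAt (deriv smoothTransition) (deriv (deriv smoothTransition) y) y :=
    fun y => (hS'.differentiable (by norm_num) y).hasDerivAt
  have m1 : ∀ y, HasDerivAt (fun x : ℝ => x / L + 2) (L⁻¹) y := by
    intro y
    have := ((hasDerivAt_id y).div_const L).add_const 2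
    simpa using this
  have m2 : ∀ y, HasDerivAt (fun x : ℝ => (X - x) / l + 1) (-l⁻¹) y := by
    intro y
    have := ((((hasDerivAt_id y).const_sub X).div_const l).add_const 1)
    refine this.congr_deriv ?_
    rw [neg_div, one_div]
  set A : ℝ → ℝ := fun x => smoothTransition (x / L + 2) with hA
  set B : ℝ → ℝ := fun x => smoothTransition ((X - x) / l + 1) with hB
  set A1 : ℝ → ℝ := fun x => deriv smoothTransition (x / L + 2) * L⁻¹ with hA1
  set B1 : ℝ → ℝ := fun x => deriv smoothTransition ((X - x) / l + 1) * (-l⁻¹) with hB1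
  set A2 : ℝ → ℝ := fun x => deriv (deriv smoothTransition) (x / L + 2) * L⁻¹ * L⁻¹ with hA2
  set B2 : ℝ → ℝ := fun x => deriv (deriv smoothTransition) ((X - x) / l + 1) * (-l⁻¹) * (-l⁻¹) with hB2
  have a1 : ∀ y, HasDerivAt A (A1 y) y := fun y => (d1 _).comp y (m1 y)
  have b1 : ∀ y, HasDerivAt B (B1 y) y := fun y => (d1 _).comp y (m2 y)
  have a2 : ∀ y, HasDerivAt A1 (A2 y) y := fun y => ((d2 _).comp y (m1 y)).mul_const _
  have b2 : ∀ y, HasDerivAt B1 (B2 y) y := fun y => ((d2 _).comp y (m2 y)).mul_const _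
  have e1 : deriv (cutf L X l) = fun y => A1 y * B y + A y * B1 y := by
    funext y
    exact ((a1 y).mul (b1 y)).deriv
  have e2 : deriv (deriv (cutf L X l)) =
      fun y => (A2 y * B y + A1 y * B1 y) + (A1 y * B1 y + A y * B2 y) := by
    rw [e1]
    funext y
    exact (((a2 y).mul (b1 y)).add ((a1 y).mul (b2 y))).deriv
  have hA01 : |A x| ≤ 1 := by
    rw [abs_of_nonneg (smoothTransition.nonneg _)]; exact smoothTransition.le_one _
  have hB01 : |B x| ≤ 1 := by
    rw [abs_of_nonneg (smoothTransition.nonneg _)]; exact smoothTransition.le_one _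
  have hc01 : |cutf L X l x| ≤ 1 := by
    rw [abs_of_nonneg (cutf_nonneg _ _ _ _)]; exact cutf_le_one _ _ _ _
  have tA : x ∉ Icc (-(2 * L)) (-L) → A1 x = 0 ∧ A2 x = 0 := by
    intro hx
    have : x / L + 2 ∉ Icc (0:ℝ) 1 := by
      intro h
      apply hx
      have h1 : -2 ≤ x / L := by linarith [h.1]
      have h2 : x / L ≤ -1 := by linarith [h.2]
      rw [le_div_iff₀ hL] at h1
      rw [div_le_iff₀ hL] at h2
      constructor <;> linarith
    simp [hA1, hA2, z1 _ this, z2 _ this]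
  have tB : x ∉ Icc X (X + l) → B1 x = 0 ∧ B2 x = 0 := by
    intro hx
    have : (X - x) / l + 1 ∉ Icc (0:ℝ) 1 := by
      intro h
      apply hx
      have h1 : -1 ≤ (X - x) / l := by linarith [h.1]
      have h2 : (X - x) / l ≤ 0 := by linarith [h.2]
      rw [le_div_iff₀ hl] at h1
      rw [div_le_iff₀ hl] at h2
      constructor <;> linarith
    simp [hB1, hB2, z1 _ this, z2 _ this]
  have bA1 : |A1 x| ≤ K * L⁻¹ := by
    simp only [hA1, abs_mul, abs_of_pos (inv_pos.2 hL)]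
    gcongr; exact k1 _
  have bA2 : |A2 x| ≤ K * L⁻¹ * L⁻¹ := by
    simp only [hA2, abs_mul, abs_of_pos (inv_pos.2 hL)]
    gcongr; exact k2 _
  have bB1 : |B1 x| ≤ K * l⁻¹ := by
    simp only [hB1, abs_mul, abs_neg, abs_of_pos (inv_pos.2 hl)]
    gcongr; exact k1 _
  have bB2 : |B2 x| ≤ K * l⁻¹ * l⁻¹ := by
    simp only [hB2, abs_mul, abs_neg, abs_of_pos (inv_pos.2 hl)]
    gcongr; exact k2 _
  -- the basic numerical estimate
  have fin : ∀ s u v : ℝ, 0 ≤ s → |u| ≤ K * s → |v| ≤ K * s * s →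
      2 * u ^ 2 + 2 * |cutf L X l x * v| ≤ (2 * K ^ 2 + 2 * K) * s ^ 2 := by
    intro s u v hs hu hv
    have h1 : u ^ 2 ≤ (K * s) ^ 2 := by
      rw [← sq_abs]; gcongr
    have h2 : |cutf L X l x * v| ≤ 1 * (K * s * s) := by
      rw [abs_mul]; gcongr
    nlinarith
  unfold qof
  rw [e2, e1]
  simp only
  by_cases hT : x ∈ Icc (-(2 * L)) (-L)
  · have hO : x ∉ Icc X (X + l) := by
      intro h
      linarith [hT.2, h.1]
    obtain ⟨w1, w2⟩ := tB hO
    rw [w1, w2, indicator_of_mem hT, indicator_of_notMem hO]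
    have := fin L⁻¹ (A1 x * B x) (A2 x * B x) (by positivity)
      (by rw [abs_mul]; calc _ ≤ K * L⁻¹ * 1 := by gcongr
                          _ = _ := by ring)
      (by rw [abs_mul]; calc _ ≤ K * L⁻¹ * L⁻¹ * 1 := by gcongr
                          _ = _ := by ring)
    simpa using this
  · obtain ⟨w1, w2⟩ := tA hT
    rw [w1, w2, indicator_of_notMem hT]
    by_cases hO : x ∈ Icc X (X + l)
    · rw [indicator_of_mem hO]
      have := fin l⁻¹ (A x * B1 x) (A x * B2 x) (by positivity)
        (by rw [abs_mul]; calc _ ≤ 1 * (K * l⁻¹) := by gcongr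
                            _ = _ := by ring)
        (by rw [abs_mul]; calc _ ≤ 1 * (K * l⁻¹ * l⁻¹) := by gcongr
                            _ = _ := by ring)
      simpa using this
    · obtain ⟨w1, w2⟩ := tB hO
      rw [w1, w2, indicator_of_notMem hO]
      simp

lemma box_int {f : ℝ → ℝ} (hf : Integrable f) (h0 : ∀ x, 0 ≤ f x) (a : ℝ) :
    IntegrableOn (fun p : ℝ × ℝ => f p.1) (box a) ∧
    ∫ p in box a, f p.1 ≤ 2 * π * ∫ x, f x := by
  have e : box a = Icc (-a) a ×ˢ Icc 0 (2 * π) := by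
    unfold box; rw [Icc_prod_Icc]
  constructor
  · rw [e]
    unfold IntegrableOn
    rw [Measure.volume_eq_prod, ← Measure.prod_restrict]
    have := (hf.integrableOn (s := Icc (-a) a)).integrable.mul_prod
      (integrable_const (1:ℝ) (μ := volume.restrict (Icc 0 (2 * π))))
    simpa using this
  · have := setIntegral_prod_mul (μ := (volume : Measure ℝ)) (ν := (volume : Measure ℝ)) f
      (fun _ => (1:ℝ)) (Icc (-a) a) (Icc 0 (2 * π))
    simp only [mul_one] at this
    rw [e, Measure.volume_eq_prod, this]
    have h2 : ∫ y in Icc 0 (2 * π), (1:ℝ) = 2 * π := by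
      have := pi_pos
      simp; positivity
    rw [h2, mul_comm]
    refine mul_le_mul_of_nonneg_left ?_ (by positivity)
    exact setIntegral_le_integral hf (Filter.Eventually.of_forall h0)

end ConeLiouville

namespace ConeLiouville

/-- unit-scale squared cutoff -/
noncomputable def cX (L X : ℝ) : ℝ → ℝ := fun x => cutf L X 1 x ^ 2
/-- the associated error weight -/
noncomputable def qX (L X : ℝ) : ℝ → ℝ := qof (cutf L X 1)

lemma cX_cut {L X a : ℝ} (hL : 0 < L) (h1 : 2 * L ≤ a) (h2 : X + 1 ≤ a) :
    Cut a (cX L X) (qX L X) := cutf_cut hL one_pos h1 h2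

lemma sq_le_of_abs {u M : ℝ} (h : |u| ≤ M) : u ^ 2 ≤ M ^ 2 := by
  rw [← sq_abs]; gcongr

lemma cX_le_one (L X x : ℝ) : cX L X x ≤ 1 :=
  pow_le_one₀ (cutf_nonneg _ _ _ _) (cutf_le_one _ _ _ _)

lemma cX_nonneg (L X x : ℝ) : 0 ≤ cX L X x := sq_nonneg _

lemma cX_cont (L X : ℝ) : Continuous (cX L X) := (cutf_cd L X 1).continuous.pow 2

lemma cX_mono (L x : ℝ) {X Y : ℝ} (h : X ≤ Y) : cX L X x ≤ cX L Y x :=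
  pow_le_pow_left₀ (cutf_nonneg _ _ _ _) (cutf_mono one_pos h) 2

lemma F1 {L X a M : ℝ} {F : ℝ × ℝ → ℝ} (hF : Continuous F) (hM : ∀ p, |F p| ≤ M) :
    II a (cX L X) F ≤ π * exp 2 * M ^ 2 * exp (2 * X) := by
  set w : ℝ → ℝ := indicator (Iic (X + 1)) (fun x => exp (2 * x)) with hw
  have hi : IntegrableOn (fun x : ℝ => exp (2 * x)) (Iic (X + 1)) := integrableOn_exp_mul_Iic two_pos _
  have hwi : Integrable w := hi.integrable_indicator measurableSet_Iic
  have hw0 : ∀ x, 0 ≤ w x := fun x => indicator_nonneg (fun _ _ => (exp_pos _).le) _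
  have hwv : ∫ x, w x = exp 2 * exp (2 * X) / 2 := by
    rw [integral_indicator measurableSet_Iic, integral_exp_mul_Iic two_pos, ← exp_add]
    ring_nf
  obtain ⟨b1, b2⟩ := box_int hwi hw0 a
  have hc := cX_cont L X
  calc II a (cX L X) F ≤ ∫ p in box a, M ^ 2 * w p.1 := by
        unfold II
        refine integral_mono (cont_int (by fun_prop) a) (b1.const_mul _) fun p => ?_
        have h2 := sq_le_of_abs (hM p)
        by_cases hp : p.1 ≤ X + 1
        · have : w p.1 = exp (2 * p.1) := indicator_of_mem (s := Iic (X + 1)) hp _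
          simp only [this]
          calc _ ≤ 1 * exp (2 * p.1) * M ^ 2 := by
                gcongr; exact cX_le_one _ _ _
            _ = _ := by ring
        · have : cX L X p.1 = 0 := by
            simp [cX, cutf_zero_right one_pos (le_of_not_ge hp)]
          simp only [this, zero_mul]
          exact mul_nonneg (sq_nonneg _) (hw0 _)
    _ = M ^ 2 * ∫ p in box a, w p.1 := integral_const_mul _ _
    _ ≤ M ^ 2 * (2 * π * (exp 2 * exp (2 * X) / 2)) := by
        rw [← hwv]; gcongr
    _ = _ := by ring

lemma ind_int (b c : ℝ) (h : b ≤ c) (a : ℝ) :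
    IntegrableOn (fun p : ℝ × ℝ => indicator (Icc b c) (1 : ℝ → ℝ) p.1) (box a) ∧
    ∫ p in box a, indicator (Icc b c) (1 : ℝ → ℝ) p.1 ≤ 2 * π * (c - b) := by
  have hi : Integrable (indicator (Icc b c) (1 : ℝ → ℝ)) := by
    rw [integrable_indicator_iff measurableSet_Icc]
    exact integrableOn_const (by simp)
  have := box_int hi (fun x => indicator_nonneg (fun _ _ => by simp) _) a
  refine ⟨this.1, this.2.trans_eq ?_⟩
  rw [integral_indicator_one measurableSet_Icc]
  simp [h]

lemma F2 : ∃ C : ℝ, 0 ≤ C ∧ ∀ (L X a M : ℝ) (F : ℝ × ℝ → ℝ), 0 < L → 0 ≤ X → Continuous F →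
    (∀ p, |F p| ≤ M) →
    (2 * L ≤ a → X + 1 ≤ a → QQ a (qX L X) F ≤
      C * (M ^ 2 * L⁻¹ + exp (-(2 * X)) * II a (cX L (X + 1)) F)) ∧
    (2 * L ≤ a → QQ a (qof (cutf L L L)) F ≤ C * (M ^ 2 * L⁻¹)) := by
  obtain ⟨C, hC, hq⟩ := q_bound
  refine ⟨C * (1 + 4 * π), by positivity, ?_⟩
  intro L X a M F hL hX hF hM
  have hM0 : 0 ≤ M := (abs_nonneg _).trans (hM 0)
  have hI1 := ind_int (-(2 * L)) (-L) (by linarith) a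
  have hI2 := ind_int L (L + L) (by linarith) a
  have e1 : (L ^ 2)⁻¹ * (2 * π * (-L - -(2 * L))) = 2 * π * L⁻¹ := by
    field_simp; ring
  have e2 : (L ^ 2)⁻¹ * (2 * π * (L + L - L)) = 2 * π * L⁻¹ := by
    field_simp; ring
  have hπ := pi_pos
  constructor
  · intro ha hXa
    have hcut := cX_cut hL ha hXa
    have hqc := hcut.qc
    have hcc := cX_cont L (X + 1)
    have hI0 := II_nonneg (a := a) (cX_nonneg L (X + 1)) F
    calc QQ a (qX L X) F ≤ ∫ p in box a, C * (M ^ 2 * ((L ^ 2)⁻¹ * indicator (Icc (-(2 * L)) (-L)) 1 p.1)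
          + exp (-(2 * X)) * (cX L (X + 1) p.1 * exp (2 * p.1) * F p ^ 2)) := by
          unfold QQ
          refine integral_mono (cont_int (by fun_prop) a)
            ((((hI1.1.const_mul _).const_mul _).add
              ((cont_int (F := fun p => cX L (X + 1) p.1 * exp (2 * p.1) * F p ^ 2)
                (by fun_prop) a).const_mul _)).const_mul _) fun p => ?_
          have h2 := sq_le_of_abs (hM p)
          have h3 := hq L X 1 p.1 hL hX one_pos
          have h4 : (0:ℝ) ≤ indicator (Icc (-(2 * L)) (-L)) 1 p.1 :=
            indicator_nonneg (fun _ _ => by simp) _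
          have h5 : indicator (Icc X (X + 1)) 1 p.1 * F p ^ 2 ≤
              exp (-(2 * X)) * (cX L (X + 1) p.1 * exp (2 * p.1) * F p ^ 2) := by
            by_cases hp : p.1 ∈ Icc X (X + 1)
            · rw [indicator_of_mem hp]
              have : cX L (X + 1) p.1 = 1 := by
                simp [cX, cutf_eq_one hL one_pos (by linarith [hp.1]) hp.2]
              rw [this]
              have h6 : 1 ≤ exp (-(2 * X)) * exp (2 * p.1) := by
                rw [← exp_add]; exact one_le_exp (by linarith [hp.1])
              calc _ = 1 * F p ^ 2 := by simp
                _ ≤ (exp (-(2 * X)) * exp (2 * p.1)) * F p ^ 2 := by gcongr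
                _ = _ := by ring
            · rw [indicator_of_notMem hp]
              have := cX_nonneg L (X + 1) p.1
              simp only [zero_mul]
              positivity
          calc qX L X p.1 * F p ^ 2 ≤ (C * ((L ^ 2)⁻¹ * indicator (Icc (-(2 * L)) (-L)) 1 p.1
                + (1 ^ 2)⁻¹ * indicator (Icc X (X + 1)) 1 p.1)) * F p ^ 2 := by gcongr; exact h3
            _ = C * (F p ^ 2 * ((L ^ 2)⁻¹ * indicator (Icc (-(2 * L)) (-L)) 1 p.1)
                + indicator (Icc X (X + 1)) 1 p.1 * F p ^ 2) := by ring
            _ ≤ _ := by gcongr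
      _ = C * (M ^ 2 * ((L ^ 2)⁻¹ * ∫ p in box a, indicator (Icc (-(2 * L)) (-L)) (1 : ℝ → ℝ) p.1)
          + exp (-(2 * X)) * II a (cX L (X + 1)) F) := by
          rw [integral_const_mul, integral_add, integral_const_mul, integral_const_mul,
            integral_const_mul]
          · rfl
          · exact (hI1.1.const_mul _).const_mul _
          · exact (cont_int (F := fun p => cX L (X + 1) p.1 * exp (2 * p.1) * F p ^ 2)
                (by fun_prop) a).const_mul _
      _ ≤ C * (M ^ 2 * ((L ^ 2)⁻¹ * (2 * π * (-L - -(2 * L))))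
          + exp (-(2 * X)) * II a (cX L (X + 1)) F) := by
          gcongr; exact hI1.2
      _ ≤ _ := by
          rw [e1, mul_assoc C]
          refine mul_le_mul_of_nonneg_left ?_ hC
          have : 0 ≤ M ^ 2 * L⁻¹ := by positivity
          have : 0 ≤ exp (-(2 * X)) * II a (cX L (X + 1)) F := by positivity
          nlinarith
  · intro ha
    have hcut := cutf_cut (X := L) hL hL ha (by linarith)
    have hqc := hcut.qc
    calc QQ a (qof (cutf L L L)) F ≤ ∫ p in box a, (C * M ^ 2) * ((L ^ 2)⁻¹ * indicator (Icc (-(2 * L)) (-L)) 1 p.1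
          + (L ^ 2)⁻¹ * indicator (Icc L (L + L)) 1 p.1) := by
          unfold QQ
          refine integral_mono (cont_int (by fun_prop) a)
            (((hI1.1.const_mul _).add (hI2.1.const_mul _)).const_mul _) fun p => ?_
          have h2 := sq_le_of_abs (hM p)
          have h3 := hq L L L p.1 hL hL.le hL
          have h0 := hcut.q0 p.1
          calc _ ≤ qof (cutf L L L) p.1 * M ^ 2 := by gcongr
            _ ≤ (C * ((L ^ 2)⁻¹ * indicator (Icc (-(2 * L)) (-L)) 1 p.1
                + (L ^ 2)⁻¹ * indicator (Icc L (L + L)) 1 p.1)) * M ^ 2 := by gcongr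
            _ = _ := by ring
      _ = (C * M ^ 2) * ((L ^ 2)⁻¹ * (∫ p in box a, indicator (Icc (-(2 * L)) (-L)) (1 : ℝ → ℝ) p.1)
          + (L ^ 2)⁻¹ * (∫ p in box a, indicator (Icc L (L + L)) (1 : ℝ → ℝ) p.1)) := by
          rw [integral_const_mul, integral_add, integral_const_mul, integral_const_mul]
          · exact hI1.1.const_mul _
          · exact hI2.1.const_mul _
      _ ≤ (C * M ^ 2) * ((L ^ 2)⁻¹ * (2 * π * (-L - -(2 * L)))
          + (L ^ 2)⁻¹ * (2 * π * (L + L - L))) := by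
          gcongr
          · exact hI1.2
          · exact hI2.2
      _ ≤ _ := by
          rw [e1, e2]
          have : 0 ≤ C * (M ^ 2 * L⁻¹) := by positivity
          nlinarith

lemma II_mono {a : ℝ} {c c' : ℝ → ℝ} (hc : Continuous c) (hc' : Continuous c') (h : ∀ x, c x ≤ c' x)
    {F : ℝ × ℝ → ℝ} (hF : Continuous F) : II a c F ≤ II a c' F := by
  unfold II
  refine integral_mono (cont_int (by fun_prop) a) (cont_int (by fun_prop) a) fun p => ?_
  have := h p.1
  simp only
  gcongr

lemma GG_mono {κ a : ℝ} (hκ : 0 ≤ κ) {c c' : ℝ → ℝ} (hc : Continuous c) (hc' : Continuous c')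
    (h : ∀ x, c x ≤ c' x) {F : ℝ × ℝ → ℝ} (hF : ContDiff ℝ 2 F) : GG κ a c F ≤ GG κ a c' F := by
  unfold GG
  have hg : Continuous (gdot κ F F) := gdot_cont (hF.of_le (by norm_num)) (hF.of_le (by norm_num))
  refine integral_mono (cont_int (by fun_prop) a) (cont_int (by fun_prop) a) fun p => ?_
  have := h p.1
  have := gdot_self_nonneg hκ F p
  simp only
  gcongr

lemma imono {H : ℝ → ℝ} {b' b c : ℝ} (h : b' ≤ b) (hc : b ≤ c) {d : ℝ} (hd : c ≤ d) (hi' : IntervalIntegrable H volume b' d)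
    (h0 : ∀ t, 0 ≤ H t) : ∫ t in b..c, H t ≤ ∫ t in b'..d, H t :=
  intervalIntegral.integral_mono_interval h hc hd (Filter.Eventually.of_forall h0) hi'

end ConeLiouville

namespace ConeLiouville

lemma S2 {κ M : ℝ} {w z : ℝ → ℝ × ℝ → ℝ} (h : Sol κ M w z) :
    ∃ C : ℝ, 0 ≤ C ∧ ∀ L Y a τ : ℝ, 1 ≤ L → 0 ≤ Y → 2 * L ≤ a → Y + 2 ≤ a → 0 ≤ τ →
      ∫ t in (-τ)..0, QQ a (qX L Y) (w t) ≤
        C * (τ * L⁻¹ + exp (-(2 * Y)) * ∫ t in (-τ)..0, II a (cX L (Y + 1)) (w t)) := by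
  obtain ⟨C, hC, hF⟩ := F2
  refine ⟨C * (M ^ 2 + 1), by positivity, ?_⟩
  intro L Y a τ hL hY ha hYa hτ
  have hL0 : 0 < L := by linarith
  have hc := cX_cut (X := Y) hL0 ha (by linarith)
  have hc1 := cX_cut (X := Y + 1) hL0 ha (by linarith)
  have hτ' : -τ ≤ 0 := by linarith
  have iI := h.II_ii hc1 hτ' le_rfl
  have iQ := h.QQ_ii hc hτ' le_rfl
  have hI0 : 0 ≤ ∫ t in (-τ)..0, II a (cX L (Y + 1)) (w t) :=
    intervalIntegral.integral_nonneg hτ' fun t _ => II_nonneg (cX_nonneg _ _) _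
  calc ∫ t in (-τ)..0, QQ a (qX L Y) (w t)
      ≤ ∫ t in (-τ)..0, C * (M ^ 2 * L⁻¹ + exp (-(2 * Y)) * II a (cX L (Y + 1)) (w t)) := by
        refine intervalIntegral.integral_mono_on hτ' iQ
          ((intervalIntegrable_const.add (iI.const_mul _)).const_mul _) fun t ht => ?_
        exact (hF L Y a M (w t) hL0 hY (h.sm t ht.2).continuous (h.bd t ht.2)).1 ha (by linarith)
    _ = C * (τ * (M ^ 2 * L⁻¹) + exp (-(2 * Y)) * ∫ t in (-τ)..0, II a (cX L (Y + 1)) (w t)) := by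
        rw [intervalIntegral.integral_const_mul, intervalIntegral.integral_add,
          intervalIntegral.integral_const, intervalIntegral.integral_const_mul]
        · simp
        · exact intervalIntegrable_const
        · exact iI.const_mul _
    _ ≤ _ := by
        rw [mul_assoc]
        refine mul_le_mul_of_nonneg_left ?_ hC
        set P := exp (-(2 * Y)) * ∫ t in (-τ)..0, II a (cX L (Y + 1)) (w t) with hP
        have hP0 : 0 ≤ P := by positivity
        have : 0 ≤ τ * L⁻¹ := by positivity
        have : 0 ≤ M ^ 2 * P := by positivity
        nlinarith

lemma S1 {κ M : ℝ} {w z : ℝ → ℝ × ℝ → ℝ} (h : Sol κ M w z) :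
    ∃ D : ℝ, 0 ≤ D ∧ ∀ L Y a τ : ℝ, 1 ≤ L → 0 ≤ Y → 2 * L ≤ a → Y + 2 ≤ a → 0 ≤ τ →
      ∫ t in (-τ)..0, QQ a (qX L Y) (w t) ≤ τ * D ∧
      ∫ t in (-τ)..0, GG κ a (cX L Y) (w t) ≤ D * exp (2 * Y) + τ * D := by
  obtain ⟨C, hC, hS⟩ := S2 h
  set A := π * exp 2 * M ^ 2 with hA
  have hA0 : 0 ≤ A := by positivity
  set D := C * (1 + A * exp 2) + A with hD
  have hD0 : 0 ≤ D := by positivity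
  refine ⟨D, hD0, ?_⟩
  intro L Y a τ hL hY ha hYa hτ
  have hL0 : 0 < L := by linarith
  have hc := cX_cut (X := Y) hL0 ha (by linarith)
  have hc1 := cX_cut (X := Y + 1) hL0 ha (by linarith)
  have hτ' : -τ ≤ 0 := by linarith
  have hQ : ∫ t in (-τ)..0, QQ a (qX L Y) (w t) ≤ τ * D := by
    refine (hS L Y a τ hL hY ha hYa hτ).trans ?_
    have h1 : ∫ t in (-τ)..0, II a (cX L (Y + 1)) (w t) ≤ τ * (A * exp (2 * (Y + 1))) := by
      calc _ ≤ ∫ t in (-τ)..0, A * exp (2 * (Y + 1)) :=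
            intervalIntegral.integral_mono_on hτ' (h.II_ii hc1 hτ' le_rfl) intervalIntegrable_const
              fun t ht => F1 (h.sm t ht.2).continuous (h.bd t ht.2)
        _ = _ := by rw [intervalIntegral.integral_const]; simp
    have h2 : exp (-(2 * Y)) * (τ * (A * exp (2 * (Y + 1)))) = τ * (A * exp 2) := by
      have : exp (2 * (Y + 1)) = exp (2 * Y) * exp 2 := by rw [← exp_add]; ring_nf
      rw [this, exp_neg]; field_simp
    have h3 : L⁻¹ ≤ 1 := inv_le_one_of_one_le₀ hL
    calc _ ≤ C * (τ * 1 + exp (-(2 * Y)) * (τ * (A * exp (2 * (Y + 1))))) := by gcongr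
      _ = τ * (C * (1 + A * exp 2)) := by rw [h2]; ring
      _ ≤ τ * D := by gcongr; linarith
  refine ⟨hQ, ?_⟩
  have e1 := (E1 h hc hτ' le_rfl).2
  have h1 : II a (cX L Y) (w (-τ)) ≤ A * exp (2 * Y) := F1 (h.sm _ hτ').continuous (h.bd _ hτ')
  have h2 := II_nonneg (a := a) (cX_nonneg L Y) (w 0)
  have h3 : A * exp (2 * Y) ≤ D * exp (2 * Y) := by
    gcongr; have : 0 ≤ C * (1 + A * exp 2) := by positivity
    linarith
  have h4 : 0 ≤ D * exp (2 * Y) := by positivity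
  have h5 : 0 ≤ τ * D := by positivity
  linarith

set_option maxHeartbeats 1000000 in
lemma iter {κ N : ℝ} (hκ : 0 ≤ κ) {f g : ℝ → ℝ × ℝ → ℝ} (h : Sol κ N f g) {s : ℝ} (hs : 0 ≤ s) :
    ∃ K : ℝ, 0 ≤ K ∧ ∀ X L a : ℝ, 0 ≤ X → s ≤ exp (2 * X) → exp (4 * X) ≤ L → 2 * L ≤ a →
      X + 4 ≤ a →
      ∫ t in (-1)..0, GG κ a (cX L X) (fun p => f (t - s) p - f t p) ≤ K * exp (-X) := by
  have hv := h.diff hs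
  obtain ⟨C, hC, hS2⟩ := S2 hv
  obtain ⟨Dv, hDv, hSv⟩ := S1 hv
  obtain ⟨Df, hDf, hSf⟩ := S1 h
  set v : ℝ → ℝ × ℝ → ℝ := fun t p => f (t - s) p - f t p with hvdef
  set K2 := s * (1 / 2 * (Dv * exp 4 + 3 * Dv) + 3 * Dv) + s * (Df * exp 4 + 4 * Df) with hK2
  have hK20 : 0 ≤ K2 := by positivity
  set K3 := K2 + C * (3 + K2) with hK3
  have hK30 : 0 ≤ K3 := by positivity
  set K4 := s * (K3 + C * (3 + K2)) + s * (Df * exp 2 + 4 * Df) with hK4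
  have hK40 : 0 ≤ K4 := by positivity
  refine ⟨K4 + C * (2 + K4), by positivity, ?_⟩
  intro X L a hX hsE hL ha hXa
  set R := exp X with hR
  have hR1 : 1 ≤ R := one_le_exp hX
  have hR0 : 0 < R := by linarith
  have eE : exp (2 * X) = R ^ 2 := by rw [hR, ← exp_nat_mul]; norm_num
  have eE4 : exp (4 * X) = R ^ 4 := by rw [hR, ← exp_nat_mul]; norm_num
  set E := R ^ 2 with hE
  have hE1 : 1 ≤ E := one_le_pow₀ hR1
  have hE0 : 0 < E := by linarith
  rw [eE] at hsE
  rw [eE4] at hL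
  have hER : R ≤ E := by rw [hE]; nlinarith
  have hL1 : 1 ≤ L := (one_le_pow₀ hR1).trans hL
  have hL0 : 0 < L := by linarith
  have hEL : E * L⁻¹ ≤ E⁻¹ := by
    rw [← div_eq_mul_inv, div_le_iff₀ hL0, ← div_eq_inv_mul, le_div_iff₀ hE0]
    calc E * E = R ^ 4 := by rw [hE]; ring
      _ ≤ L := hL
  have hEi : E⁻¹ ≤ 1 := inv_le_one_of_one_le₀ hE1
  have hERi : E⁻¹ ≤ R⁻¹ := inv_anti₀ hR0 hER
  have x2 : exp (2 * (X + 2)) = exp 4 * E := by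
    rw [← eE, ← exp_add]; ring_nf
  have x1 : exp (2 * (X + 1)) = exp 2 * E := by
    rw [← eE, ← exp_add]; ring_nf
  have x0 : exp (-(2 * X)) = E⁻¹ := by rw [exp_neg, eE]
  have x1i : exp (-(2 * (X + 1))) ≤ E⁻¹ := by
    rw [← x0]; exact exp_le_exp.2 (by linarith)
  have c0 := cX_cut (X := X) hL0 ha (by linarith)
  have c1 := cX_cut (X := X + 1) hL0 ha (by linarith)
  have c2 := cX_cut (X := X + 2) hL0 ha (by linarith)
  have nGv : ∀ Y t, 0 ≤ GG κ a (cX L Y) (v t) := fun Y t => GG_nonneg hκ (cX_nonneg _ _) _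
  have nGf : ∀ Y t, 0 ≤ GG κ a (cX L Y) (f t) := fun Y t => GG_nonneg hκ (cX_nonneg _ _) _
  have nI : ∀ Y t, 0 ≤ II a (cX L Y) (v t) := fun Y t => II_nonneg (cX_nonneg _ _) _
  have nQ : ∀ t, 0 ≤ QQ a (qX L (X + 1)) (v t) := fun t => QQ_nonneg c1 _
  -- step 2
  have st2 : ∫ t in (-(3 * E))..0, II a (cX L (X + 2)) (v t) ≤ K2 * E := by
    have e2 := E2 hκ h hs c2 one_pos (t1 := -(3 * E)) (t2 := 0) (by linarith) le_rfl
    have q := hSv L (X + 2) a (3 * E) hL1 (by linarith) ha (by linarith) (by linarith)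
    have r := (hSf L (X + 2) a (4 * E) hL1 (by linarith) ha (by linarith) (by linarith)).2
    have m : ∫ t in (-(3 * E) - s)..0, GG κ a (cX L (X + 2)) (f t) ≤
        ∫ t in (-(4 * E))..0, GG κ a (cX L (X + 2)) (f t) :=
      imono (by linarith) (by linarith) le_rfl
        (E1 h c2 (by linarith) le_rfl).1 (nGf _)
    rw [x2] at q r
    calc _ ≤ _ := e2
      _ ≤ s * (1 * (1 / 2 * (Dv * (exp 4 * E) + 3 * E * Dv) + 3 * E * Dv))
          + 1⁻¹ * (s * (Df * (exp 4 * E) + 4 * E * Df)) := by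
          gcongr
          · exact q.2
          · exact q.1
          · exact m.trans r
      _ = K2 * E := by rw [hK2]; ring
  have Q1 : ∫ t in (-(3 * E))..0, QQ a (qX L (X + 1)) (v t) ≤ C * (3 + K2) := by
    have q := hS2 L (X + 1) a (3 * E) hL1 (by linarith) ha (by linarith) (by linarith)
    rw [show X + 1 + 1 = X + 2 by ring] at q
    calc _ ≤ _ := q
      _ ≤ C * (3 * (E * L⁻¹) + E⁻¹ * (K2 * E)) := by
          rw [mul_assoc]
          gcongr
          exact intervalIntegral.integral_nonneg (by linarith) fun t _ => nI _ _
      _ ≤ C * (3 * 1 + K2) := by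
          have : E⁻¹ * (K2 * E) = K2 := by field_simp
          rw [this]
          gcongr
          exact hEL.trans hEi
      _ = _ := by ring
  -- step 3
  have st3 : ∫ t in (-(2 * E))..0, GG κ a (cX L (X + 1)) (v t) ≤ K3 := by
    have e := E1' hκ hv c1 (b := 2 * E) (T := E) (by linarith) hE0.le
    rw [show -(2 * E) - E = -(3 * E) by ring] at e
    have m1 : ∫ t in (-(3 * E))..(-(2 * E)), II a (cX L (X + 1)) (v t) ≤
        ∫ t in (-(3 * E))..0, II a (cX L (X + 1)) (v t) :=
      imono le_rfl (by linarith) (by linarith) (hv.II_ii c1 (by linarith) le_rfl) (nI _)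
    have m2 : ∫ t in (-(3 * E))..0, II a (cX L (X + 1)) (v t) ≤
        ∫ t in (-(3 * E))..0, II a (cX L (X + 2)) (v t) :=
      intervalIntegral.integral_mono_on (by linarith) (hv.II_ii c1 (by linarith) le_rfl)
        (hv.II_ii c2 (by linarith) le_rfl) fun t ht =>
          II_mono (cX_cont _ _) (cX_cont _ _) (fun x => cX_mono L x (by linarith))
            (hv.sm t ht.2).continuous
    have n := intervalIntegral.integral_nonneg (μ := volume) (a := -(2 * E)) (b := 0)
      (by linarith) fun t _ => nGv (X + 1) t
    have : E * (2 * ∫ t in (-(2 * E))..0, GG κ a (cX L (X + 1)) (v t)) ≤ E * K3 := by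
      calc _ ≤ _ := e
        _ ≤ K2 * E + E * (C * (3 + K2)) := by
            gcongr
            linarith
        _ = E * K3 := by rw [hK3]; ring
    have := le_of_mul_le_mul_left this hE0
    linarith
  -- step 4
  have st4 : ∫ t in (-(2 * E))..0, II a (cX L (X + 1)) (v t) ≤ K4 * R := by
    have e2 := E2 hκ h hs c1 hR0 (t1 := -(2 * E)) (t2 := 0) (by linarith) le_rfl
    have r := (hSf L (X + 1) a (4 * E) hL1 (by linarith) ha (by linarith) (by linarith)).2
    have m : ∫ t in (-(2 * E) - s)..0, GG κ a (cX L (X + 1)) (f t) ≤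
        ∫ t in (-(4 * E))..0, GG κ a (cX L (X + 1)) (f t) :=
      imono (by linarith) (by linarith) le_rfl
        (E1 h c1 (by linarith) le_rfl).1 (nGf _)
    have mq : ∫ t in (-(2 * E))..0, QQ a (qX L (X + 1)) (v t) ≤
        ∫ t in (-(3 * E))..0, QQ a (qX L (X + 1)) (v t) :=
      imono (by linarith) (by linarith) le_rfl (hv.QQ_ii c1 (by linarith) le_rfl) nQ
    have n := intervalIntegral.integral_nonneg (μ := volume) (a := -(2 * E)) (b := 0)
      (by linarith) fun t _ => nGv (X + 1) t
    rw [x1] at r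
    calc _ ≤ _ := e2
      _ ≤ s * (R * (K3 + C * (3 + K2)))
          + R⁻¹ * (s * (Df * (exp 2 * E) + 4 * E * Df)) := by
          gcongr
          · linarith
          · exact mq.trans Q1
          · exact m.trans r
      _ = K4 * R := by rw [hK4, hE]; field_simp
  -- step 5
  have Q0 : ∫ t in (-(2 * E))..0, QQ a (qX L X) (v t) ≤ C * (2 + K4) * R⁻¹ := by
    have q := hS2 L X a (2 * E) hL1 (by linarith) ha (by linarith) (by linarith)
    rw [x0] at q
    calc _ ≤ _ := q
      _ ≤ C * (2 * (E * L⁻¹) + E⁻¹ * (K4 * R)) := by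
          rw [mul_assoc]
          gcongr
      _ ≤ C * (2 * R⁻¹ + K4 * R⁻¹) := by
          have : E⁻¹ * (K4 * R) = K4 * R⁻¹ := by rw [hE]; field_simp
          rw [this]
          gcongr
          exact hEL.trans hERi
      _ = _ := by ring
  have e := E1' hκ hv c0 (b := E) (T := E) (by linarith) hE0.le
  rw [show -E - E = -(2 * E) by ring] at e
  have m1 : ∫ t in (-(2 * E))..(-E), II a (cX L X) (v t) ≤
      ∫ t in (-(2 * E))..0, II a (cX L X) (v t) :=
    imono le_rfl (by linarith) (by linarith) (hv.II_ii c0 (by linarith) le_rfl) (nI _)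
  have m2 : ∫ t in (-(2 * E))..0, II a (cX L X) (v t) ≤
      ∫ t in (-(2 * E))..0, II a (cX L (X + 1)) (v t) :=
    intervalIntegral.integral_mono_on (by linarith) (hv.II_ii c0 (by linarith) le_rfl)
      (hv.II_ii c1 (by linarith) le_rfl) fun t ht =>
        II_mono (cX_cont _ _) (cX_cont _ _) (fun x => cX_mono L x (by linarith))
          (hv.sm t ht.2).continuous
  have n := intervalIntegral.integral_nonneg (μ := volume) (a := -E) (b := 0)
    (by linarith) fun t _ => nGv X t
  have fin : E * (2 * ∫ t in (-E)..0, GG κ a (cX L X) (v t)) ≤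
      E * ((K4 + C * (2 + K4)) * R⁻¹) := by
    calc _ ≤ _ := e
      _ ≤ K4 * R + E * (C * (2 + K4) * R⁻¹) := by
          gcongr
          linarith
      _ = _ := by rw [hE]; field_simp
  have fin := le_of_mul_le_mul_left fin hE0
  have m3 : ∫ t in (-1)..0, GG κ a (cX L X) (v t) ≤ ∫ t in (-E)..0, GG κ a (cX L X) (v t) :=
    imono (by linarith) (by linarith) le_rfl (E1 hv c0 (by linarith) le_rfl).1 (nGv _)
  rw [exp_neg]
  linarith

end ConeLiouville

namespace ConeLiouville

/-- open strip -/
def strip (m : ℝ) : Set (ℝ × ℝ) := Ioo (-m) m ×ˢ Ioo 0 (2 * π)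

lemma strip_open (m : ℝ) : IsOpen (strip m) := isOpen_Ioo.prod isOpen_Ioo

lemma strip_sub {m a : ℝ} (h : m ≤ a) : strip m ⊆ box a := by
  intro p hp
  obtain ⟨⟨h1, h2⟩, h3, h4⟩ := hp
  exact ⟨⟨by simp only; linarith, h3.le⟩, ⟨by simp only; linarith, h4.le⟩⟩

lemma box_sub {a b : ℝ} (h : a ≤ b) : box a ⊆ box b :=
  Icc_subset_Icc ⟨by simp only; linarith, le_rfl⟩ ⟨h, le_rfl⟩

lemma GG_cmp {κ m L X l a : ℝ} (hκ : 0 ≤ κ) (hm : 1 ≤ m) (hL : 2 * m ≤ L) (hX : m + 1 ≤ X)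
    (hl : 0 < l) (ha : 2 * m + 2 ≤ a) {F : ℝ × ℝ → ℝ} (hF : ContDiff ℝ 2 F) :
    GG κ (2 * m + 2) (cX m m) F ≤ GG κ a (fun x => cutf L X l x ^ 2) F := by
  have hg : Continuous (gdot κ F F) := gdot_cont hF hF
  have hc := cX_cont m m
  have h1 : GG κ (2 * m + 2) (cX m m) F ≤ GG κ a (cX m m) F := by
    unfold GG
    refine setIntegral_mono_set (cont_int (by fun_prop) a) ?_ (box_sub ha).eventuallyLE
    exact Filter.Eventually.of_forall fun p =>
      mul_nonneg (cX_nonneg _ _ _) (gdot_self_nonneg hκ F p)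
  refine h1.trans (GG_mono hκ hc ((cutf_cd L X l).continuous.pow 2) (fun x => ?_) hF)
  show cX m m x ≤ cutf L X l x ^ 2
  by_cases h2 : x ≤ -(2 * m)
  · have : cX m m x = 0 := by simp [cX, cutf_zero_left (by linarith) h2]
    rw [this]; positivity
  by_cases h3 : m + 1 ≤ x
  · have : cX m m x = 0 := by simp [cX, cutf_zero_right one_pos h3]
    rw [this]; positivity
  rw [cutf_eq_one (by linarith) hl (by linarith) (by linarith)]
  simpa using cX_le_one m m x

lemma GG_zero {κ m : ℝ} (hκ : 0 < κ) (hm : 1 ≤ m) {F : ℝ × ℝ → ℝ} (hF : ContDiff ℝ 2 F)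
    (h : GG κ (2 * m + 2) (cX m m) F = 0) : ∀ p ∈ strip m, dx F p = 0 ∧ dy F p = 0 := by
  have hg : Continuous (gdot κ F F) := gdot_cont hF hF
  have hc := cX_cont m m
  have hcont : Continuous (fun p : ℝ × ℝ => cX m m p.1 * gdot κ F F p) := by fun_prop
  unfold GG at h
  rw [setIntegral_eq_zero_iff_of_nonneg_ae (Filter.Eventually.of_forall fun p =>
      mul_nonneg (cX_nonneg _ _ _) (gdot_self_nonneg hκ.le F p)) (cont_int hcont _)] at h
  have h' := ae_restrict_of_ae_restrict_of_subset (strip_sub (m := m) (a := 2 * m + 2) (by linarith)) h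
  have h2 := Measure.eqOn_open_of_ae_eq h' (strip_open m) hcont.continuousOn continuousOn_const
  intro p hp
  have h3 := h2 hp
  have h4 : cX m m p.1 = 1 := by
    simp [cX, cutf_eq_one (show 0 < m by linarith) one_pos hp.1.1.le hp.1.2.le]
  simp only [h4, one_mul, Pi.zero_apply, gdot] at h3
  have a1 := mul_self_nonneg (dx F p)
  have a2 := mul_self_nonneg (dy F p)
  have a3 := mul_nonneg hκ.le a2
  constructor
  · exact mul_self_eq_zero.1 (by linarith)
  · have : κ * (dy F p * dy F p) = 0 := by linarith
    exact mul_self_eq_zero.1 ((mul_eq_zero.1 this).resolve_left hκ.ne')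

lemma lap_zero {κ m : ℝ} {F : ℝ × ℝ → ℝ} (h : ∀ p ∈ strip m, dx F p = 0 ∧ dy F p = 0)
    {p : ℝ × ℝ} (hp : p ∈ strip m) : lap κ F p = 0 := by
  have n := (strip_open m).mem_nhds hp
  have e1 : dx F =ᶠ[nhds p] fun _ => 0 := by
    filter_upwards [n] with q hq using (h q hq).1
  have e2 : dy F =ᶠ[nhds p] fun _ => 0 := by
    filter_upwards [n] with q hq using (h q hq).2
  have f1 : dx (dx F) p = 0 := by
    show fderiv ℝ (dx F) p (1, 0) = 0
    rw [e1.fderiv_eq]; simp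
  have f2 : dy (dy F) p = 0 := by
    show fderiv ℝ (dy F) p (0, 1) = 0
    rw [e2.fderiv_eq]; simp
  simp [lap, f1, f2]

lemma mem_strip (p : ℝ × ℝ) (hp : p.2 ∈ Ioo 0 (2 * π)) : p ∈ strip (|p.1| + 1) := by
  refine ⟨⟨?_, ?_⟩, hp⟩
  · linarith [neg_abs_le p.1]
  · linarith [le_abs_self p.1]

lemma g_shift {κ N : ℝ} (hκ : 0 < κ) {f g : ℝ → ℝ × ℝ → ℝ} (h : Sol κ N f g) {s : ℝ} (hs : 0 ≤ s)
    {p : ℝ × ℝ} (hp : p.2 ∈ Ioo 0 (2 * π)) : g (-s) p = g 0 p := by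
  have hv := h.diff hs
  obtain ⟨K, hK, hit⟩ := iter hκ.le h hs
  set v : ℝ → ℝ × ℝ → ℝ := fun t p => f (t - s) p - f t p with hvdef
  set m := |p.1| + 1 with hm
  have hm1 : 1 ≤ m := by have := abs_nonneg p.1; linarith
  have c0 := cX_cut (L := m) (X := m) (a := 2 * m + 2) (by linarith) (by linarith) (by linarith)
  have iG := (E1 hv c0 (t1 := -1) (by norm_num) le_rfl).1
  have n : ∀ t, 0 ≤ GG κ (2 * m + 2) (cX m m) (v t) := fun t => GG_nonneg hκ.le (cX_nonneg _ _) _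
  have z : ∫ t in (-1)..0, GG κ (2 * m + 2) (cX m m) (v t) = 0 := by
    refine le_antisymm ?_ (intervalIntegral.integral_nonneg (by norm_num) fun t _ => n t)
    have lim : Filter.Tendsto (fun X => K * exp (-X)) Filter.atTop (nhds 0) := by
      simpa using tendsto_exp_neg_atTop_nhds_zero.const_mul K
    refine ge_of_tendsto lim ?_
    filter_upwards [Filter.eventually_ge_atTop (m + 1), Filter.eventually_ge_atTop s] with X hX hsX
    have hX0 : 0 ≤ X := by linarith
    set L := exp (4 * X) + 2 * m with hL
    set a := 2 * L + X + 4 with ha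
    have hL0 : 2 * m ≤ L := by have := exp_pos (4 * X); linarith
    have hsX' : s ≤ exp (2 * X) := by have := add_one_le_exp (2 * X); linarith
    refine le_trans ?_ (hit X L a hX0 hsX' (by linarith) (by linarith) (by linarith))
    have cc := cX_cut (L := L) (X := X) (a := a) (by linarith) (by linarith) (by linarith)
    refine intervalIntegral.integral_mono_on (by norm_num) iG
      (E1 hv cc (by norm_num) le_rfl).1 fun t ht => ?_
    exact GG_cmp hκ.le hm1 hL0 hX one_pos (by linarith) (hv.sm t ht.2)
  rw [intervalIntegral.integral_eq_zero_iff_of_le_of_nonneg_ae (by norm_num)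
    (Filter.Eventually.of_forall n) iG] at z
  have hae : (fun t => g (t - s) p) =ᵐ[volume.restrict (Icc (-1) 0)] fun t => g t p := by
    rw [Measure.restrict_congr_set Ioc_ae_eq_Icc.symm]
    filter_upwards [z, ae_restrict_mem measurableSet_Ioc] with t ht htm
    have e := lap_zero (κ := κ) (GG_zero hκ hm1 (hv.sm t htm.2) ht) (mem_strip p hp)
    have e2 := hv.pde t htm.2 p
    rw [e] at e2
    have := (mul_eq_zero.1 e2).resolve_left (exp_pos _).ne'
    linarith
  have hc2 : ContinuousOn (fun t => g t p) (Icc (-1) 0) := (h.gc p).mono fun t ht => ht.2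
  have hc1 : ContinuousOn (fun t => g (t - s) p) (Icc (-1) 0) :=
    (h.gc p).comp (f := fun t => t - s) (by fun_prop) fun t ht => by
      have := ht.2
      simp only [mem_Iic]; linarith
  have := Measure.eqOn_Icc_of_ae_eq volume (by norm_num) hae hc1 hc2
    (show (0:ℝ) ∈ Icc (-1) 0 by simp)
  simpa using this

lemma g_zero {κ N : ℝ} (hκ : 0 < κ) {f g : ℝ → ℝ × ℝ → ℝ} (h : Sol κ N f g) {t : ℝ} (ht : t ≤ 0)
    {p : ℝ × ℝ} (hp : p.2 ∈ Ioo 0 (2 * π)) : g t p = 0 := by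
  have hg : ∀ t ≤ 0, g t p = g 0 p := fun t ht => by
    have := g_shift hκ h (s := -t) (by linarith) hp
    simpa using this
  have key : ∀ r > 0, |g 0 p| * r ≤ 2 * N := by
    intro r hr
    obtain ⟨c, hc, he⟩ := exists_hasDerivAt_eq_slope (fun s => f s p) (fun s => g s p)
      (a := -r) (b := 0) (by linarith) ((h.fc p).mono fun t ht => ht.2)
      (fun x hx => h.hd x hx.2.le p)
    rw [hg c hc.2.le, eq_div_iff (by linarith)] at he
    have b1 := abs_le.1 (h.bd 0 le_rfl p)
    have b2 := abs_le.1 (h.bd (-r) (by linarith) p)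
    rw [show |g 0 p| * r = |g 0 p * (0 - -r)| by rw [abs_mul]; simp [abs_of_pos hr], he, abs_le]
    constructor <;> linarith [b1.1, b1.2, b2.1, b2.2]
  rw [hg t ht]
  by_contra hne
  have hpos := abs_pos.2 hne
  have hN : 0 ≤ N := (abs_nonneg _).trans (h.bd 0 le_rfl 0)
  have := key ((2 * N + 1) / |g 0 p|) (by positivity)
  rw [mul_div_cancel₀ _ hpos.ne'] at this
  linarith

lemma static {κ N : ℝ} (hκ : 0 < κ) {f g : ℝ → ℝ × ℝ → ℝ} (h : Sol κ N f g) 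
    {p : ℝ × ℝ} (hp : p.2 ∈ Ioo 0 (2 * π)) : f 0 p = f 0 (0, π) := by
  have hF := h.sm 0 le_rfl
  have hlap : ∀ q : ℝ × ℝ, q.2 ∈ Icc 0 (2 * π) → lap κ (f 0) q = 0 := by
    have hcl : IsClosed {q : ℝ × ℝ | lap κ (f 0) q = 0} :=
      isClosed_eq (lap_cont hF) continuous_const
    have hsub : (univ : Set ℝ) ×ˢ Ioo 0 (2 * π) ⊆ {q : ℝ × ℝ | lap κ (f 0) q = 0} := by
      rintro q ⟨-, hq⟩
      have := h.pde 0 le_rfl q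
      rw [g_zero hκ h le_rfl hq, mul_zero] at this
      exact this.symm
    intro q hq
    have h1 := hcl.closure_subset_iff.2 hsub
    apply h1
    rw [closure_prod_eq, closure_Ioo (by positivity)]
    exact ⟨by simp, hq⟩
  obtain ⟨C, hC, hF2⟩ := F2
  have zero : ∀ m, 1 ≤ m → GG κ (2 * m + 2) (cX m m) (f 0) = 0 := by
    intro m hm1
    refine le_antisymm ?_ (GG_nonneg hκ.le (cX_nonneg _ _) _)
    have lim : Filter.Tendsto (fun L : ℝ => 1 / 2 * (C * (N ^ 2 * L⁻¹))) Filter.atTop (nhds 0) := by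
      simpa using ((tendsto_inv_atTop_zero.const_mul (N ^ 2)).const_mul C).const_mul (1 / 2 : ℝ)
    refine ge_of_tendsto lim ?_
    filter_upwards [Filter.eventually_ge_atTop (2 * m)] with L hL
    have hL0 : 0 < L := by linarith
    have cc := cutf_cut (L := L) (X := L) (l := L) (a := 2 * L) hL0 hL0 le_rfl (by linarith)
    refine (GG_cmp (L := L) (X := L) (l := L) (a := 2 * L) hκ.le hm1 hL (by linarith) hL0 (by linarith) hF).trans ?_
    have hQ := (hF2 L 0 (2 * L) N (f 0) hL0 le_rfl hF.continuous (h.bd 0 le_rfl)).2 le_rfl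
    have gr := green2 (κ := κ) cc.ha cc.cd cc.supp cc.supp' hF (h.per 0 le_rfl)
    unfold GG
    rw [gr]
    have z : ∫ p in box (2 * L), cutf L L L p.1 ^ 2 * f 0 p * lap κ (f 0) p = 0 := by
      refine setIntegral_eq_zero_of_forall_eq_zero fun q hq => ?_
      rw [hlap q ⟨hq.1.2, hq.2.2⟩, mul_zero]
    rw [z, neg_zero, zero_add]
    refine mul_le_mul_of_nonneg_left (le_trans ?_ hQ) (by norm_num)
    unfold QQ
    have k1 := cc.cont2
    have k2 := cc.qc
    have k3 := hF.continuous
    refine integral_mono (cont_int (by fun_prop) _) (cont_int (by fun_prop) _) fun q => ?_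
    have := (le_abs_self _).trans (cc.q1 q.1)
    simp only
    gcongr
  set m := |p.1| + 1 with hm
  have hm1 : 1 ≤ m := by have := abs_nonneg p.1; linarith
  have hz := GG_zero hκ hm1 hF (zero m hm1)
  refine (strip_open m).is_const_of_fderiv_eq_zero (𝕜 := ℝ) ?_
    (hF.differentiable (by norm_num)).differentiableOn ?_ (mem_strip p hp) ?_
  · exact ((convex_Ioo _ _).prod (convex_Ioo _ _)).isPreconnected
  · intro q hq
    obtain ⟨h1, h2⟩ := hz q hq
    ext
    · simpa [dx] using h1
    · simpa [dy] using h2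
  · have := pi_pos
    refine ⟨⟨?_, ?_⟩, ?_, ?_⟩ <;> simp only <;> linarith

/-- the Liouville property on the cylinder -/
lemma liouville {κ N : ℝ} (hκ : 0 < κ) {f g : ℝ → ℝ × ℝ → ℝ} (h : Sol κ N f g)
    {p : ℝ × ℝ} (hp : p.2 ∈ Ioo 0 (2 * π)) {t : ℝ} (ht : t ≤ 0) : f t p = f 0 (0, π) := by
  rcases ht.eq_or_lt with rfl | ht'
  · exact static hκ h hp
  · rw [← static hκ h hp]
    obtain ⟨c, hc, he⟩ := exists_hasDerivAt_eq_slope (fun s => f s p) (fun s => g s p)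
      (a := t) (b := 0) ht' ((h.fc p).mono fun t ht => ht.2)
      (fun x hx => h.hd x hx.2.le p)
    rw [g_zero hκ h hc.2.le hp, eq_div_iff (by linarith)] at he
    linarith

end ConeLiouville

namespace ConeLiouville

lemma dx_eq {F : ℝ × ℝ → ℝ} {x y : ℝ} (hF : DifferentiableAt ℝ F (x, y)) :
    dx F (x, y) = deriv (fun r => F (r, y)) x := by
  have h1 : HasDerivAt (fun r : ℝ => (r, y)) ((1, 0) : ℝ × ℝ) x :=
    (hasDerivAt_id x).prodMk (hasDerivAt_const x y)
  exact (hF.hasFDerivAt.comp_hasDerivAt x h1).deriv.symm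

lemma dy_eq {F : ℝ × ℝ → ℝ} {x y : ℝ} (hF : DifferentiableAt ℝ F (x, y)) :
    dy F (x, y) = deriv (fun r => F (x, r)) y := by
  have h1 : HasDerivAt (fun r : ℝ => (x, r)) ((0, 1) : ℝ × ℝ) y :=
    (hasDerivAt_const y x).prodMk (hasDerivAt_id y)
  exact (hF.hasFDerivAt.comp_hasDerivAt y h1).deriv.symm

lemma log_deriv2 {w : ℝ → ℝ} (hw : ContDiffOn ℝ 2 w (Ioi 0)) (x : ℝ) :
    deriv (fun r => deriv (fun r' => w (exp r')) r) x =
      exp (2 * x) * (deriv (fun r => deriv w r) (exp x) + (exp x)⁻¹ * deriv w (exp x)) := by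
  have h2 : ContDiffOn ℝ (1 + 1) w (Ioi 0) := hw.of_le (by norm_num)
  rw [contDiffOn_succ_iff_deriv_of_isOpen isOpen_Ioi] at h2
  have d1 : ∀ ρ, 0 < ρ → HasDerivAt w (deriv w ρ) ρ := fun ρ hρ =>
    ((h2.1 ρ hρ).differentiableAt (Ioi_mem_nhds hρ)).hasDerivAt
  have d2 : ∀ ρ, 0 < ρ → HasDerivAt (deriv w) (deriv (deriv w) ρ) ρ := fun ρ hρ =>
    ((h2.2.2.differentiableOn (by norm_num) ρ hρ).differentiableAt (Ioi_mem_nhds hρ)).hasDerivAt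
  have e1 : (fun r => deriv (fun r' => w (exp r')) r) = fun r => deriv w (exp r) * exp r := by
    funext r
    exact ((d1 _ (exp_pos r)).comp r (Real.hasDerivAt_exp r)).deriv
  rw [e1]
  have : HasDerivAt (fun r => deriv w (exp r) * exp r)
      (deriv (deriv w) (exp x) * exp x * exp x + deriv w (exp x) * exp x) x :=
    ((d2 _ (exp_pos x)).comp x (Real.hasDerivAt_exp x)).mul (Real.hasDerivAt_exp x)
  rw [this.deriv]
  have e : exp (2 * x) = exp x * exp x := by rw [← exp_add]; ring_nf
  rw [e]
  field_simp

lemma slice_bound {b a : ℝ} (hb : 0 < b) (D : ℝ → ℝ) :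
    ∫⁻ x in Icc (-a) a, ENNReal.ofReal (D (exp x) ^ 2) ≤
      ENNReal.ofReal (exp (2 * a) / b) *
        ∫⁻ ρ in Ioo 0 (exp a + 1), ENNReal.ofReal (D ρ ^ 2 * (b * ρ)) := by
  have cv := lintegral_image_eq_lintegral_abs_deriv_mul (s := Icc (-a) a) (f := exp) (f' := exp)
    measurableSet_Icc (fun x _ => (Real.hasDerivAt_exp x).hasDerivWithinAt) exp_injective.injOn
    (fun ρ => ENNReal.ofReal (D ρ ^ 2 * (b * ρ)))
  have sub : Set.image exp (Icc (-a) a) ⊆ Ioo 0 (exp a + 1) := by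
    rintro _ ⟨x, hx, rfl⟩
    have := exp_le_exp.2 hx.2
    exact ⟨exp_pos x, by linarith⟩
  calc ∫⁻ x in Icc (-a) a, ENNReal.ofReal (D (exp x) ^ 2)
      ≤ ∫⁻ x in Icc (-a) a, ENNReal.ofReal (exp (2 * a) / b) *
          (ENNReal.ofReal |exp x| * ENNReal.ofReal (D (exp x) ^ 2 * (b * exp x))) := by
        refine setLIntegral_mono' measurableSet_Icc fun x hx => ?_
        rw [← ENNReal.ofReal_mul (abs_nonneg _), ← ENNReal.ofReal_mul (by positivity)]
        apply ENNReal.ofReal_le_ofReal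
        rw [abs_of_pos (exp_pos x)]
        have h1 : 1 ≤ exp (2 * a) * exp x * exp x := by
          rw [← exp_add, ← exp_add]; exact one_le_exp (by linarith [hx.1])
        calc D (exp x) ^ 2 = D (exp x) ^ 2 * 1 := by ring
          _ ≤ D (exp x) ^ 2 * (exp (2 * a) * exp x * exp x) := by gcongr
          _ = _ := by field_simp
    _ = ENNReal.ofReal (exp (2 * a) / b) *
          ∫⁻ ρ in Set.image exp (Icc (-a) a), ENNReal.ofReal (D ρ ^ 2 * (b * ρ)) := by
        rw [lintegral_const_mul' _ _ ENNReal.ofReal_ne_top, cv]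
    _ ≤ _ := by
        gcongr

lemma int_of {b τ a T : ℝ} (hb : 0 < b) (hτ : τ < 0) (D : ℝ → ℝ → ℝ → ℝ)
    (hc : ∀ p : ℝ × ℝ, ContinuousOn (fun t => D (exp p.1) p.2 (t + τ)) (Iic 0))
    (hx : ∀ t ≤ 0, Continuous (fun p : ℝ × ℝ => D (exp p.1) p.2 (t + τ)))
    (hE : ∀ R T : ℝ, 0 < R → 0 < T →
      (∫⁻ t in Set.Ico (-T) (0:ℝ), ∫⁻ θ in Icc (0:ℝ) (2 * π), ∫⁻ ρ in Ioo (0:ℝ) R,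
          ENNReal.ofReal ((D ρ θ t) ^ 2 * (b * ρ))) ≠ ⊤) :
    IntegrableOn (Function.uncurry (fun t (p : ℝ × ℝ) => D (exp p.1) p.2 (t + τ)))
      (Icc (-T) 0 ×ˢ box a) := by
  set g : ℝ → ℝ × ℝ → ℝ := fun t p => D (exp p.1) p.2 (t + τ) with hg
  have m : Measurable (Function.uncurry (fun t p => g (min t 0) p)) := by
    apply measurable_uncurry_of_continuous_of_measurable
    · intro p
      exact (hc p).comp_continuous (by fun_prop) (fun t => show min t 0 ≤ 0 from min_le_right _ _)
    · intro t
      exact (hx _ (min_le_right _ _)).measurable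
  have hae : Function.uncurry g =ᵐ[volume.restrict (Icc (-T) 0 ×ˢ box a)]
      Function.uncurry (fun t p => g (min t 0) p) := by
    filter_upwards [ae_restrict_mem (measurableSet_Icc.prod (box_meas a))] with x hx
    have : x.1 ≤ 0 := hx.1.2
    simp [Function.uncurry, min_eq_left this]
  have gm : AEStronglyMeasurable (Function.uncurry g) (volume.restrict (Icc (-T) 0 ×ˢ box a)) :=
    m.aestronglyMeasurable.congr hae.symm
  have hfin : volume (Icc (-T) 0 ×ˢ box a) < ⊤ := (isCompact_Icc.prod (box_compact a)).measure_lt_top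
  have : IsFiniteMeasure (volume.restrict (Icc (-T) 0 ×ˢ box a)) := ⟨by simpa using hfin⟩
  have sq : Integrable (fun x => Function.uncurry g x ^ 2) (volume.restrict (Icc (-T) 0 ×ˢ box a)) := by
    refine ⟨gm.pow 2, ?_⟩
    rw [hasFiniteIntegral_iff_ofReal (Filter.Eventually.of_forall fun x => sq_nonneg _)]
    rw [Measure.volume_eq_prod, setLIntegral_prod]
    swap
    · rw [← Measure.volume_eq_prod]
      exact (gm.pow 2).aemeasurable.ennreal_ofReal
    set T' := |T| + 1 - τ with hT'
    have hT0 : 0 < T' := by have := abs_nonneg T; linarith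
    set H : ℝ → ℝ≥0∞ := fun t => ∫⁻ θ in Icc (0:ℝ) (2 * π), ∫⁻ ρ in Ioo (0:ℝ) (exp a + 1),
          ENNReal.ofReal ((D ρ θ t) ^ 2 * (b * ρ)) with hH
    have hEH := hE (exp a + 1) T' (by positivity) hT0
    have s1 : ∀ t ∈ Icc (-T) 0, ∫⁻ p in box a, ENNReal.ofReal (Function.uncurry g (t, p) ^ 2) ≤
        ENNReal.ofReal (exp (2 * a) / b) * H (t + τ) := by
      intro t ht
      have e : box a = Icc (-a) a ×ˢ Icc 0 (2 * π) := by
        unfold box; rw [Icc_prod_Icc]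
      have hgt : Continuous (g t) := hx t ht.2
      rw [e, Measure.volume_eq_prod, ← Measure.prod_restrict, lintegral_prod_symm]
      · rw [hH, ← lintegral_const_mul' _ _ ENNReal.ofReal_ne_top]
        refine lintegral_mono fun y => ?_
        exact slice_bound hb (fun ρ => D ρ y (t + τ))
      · exact ((hgt.pow 2).measurable.ennreal_ofReal).aemeasurable
    calc _ ≤ ∫⁻ t in Icc (-T) 0, ENNReal.ofReal (exp (2 * a) / b) * H (t + τ) :=
          setLIntegral_mono' measurableSet_Icc s1
      _ = ENNReal.ofReal (exp (2 * a) / b) * ∫⁻ t in Icc (-T) 0, H (t + τ) :=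
          lintegral_const_mul' _ _ ENNReal.ofReal_ne_top
      _ ≤ ENNReal.ofReal (exp (2 * a) / b) * ∫⁻ t in Ico (-T') 0, H t := by
          refine mul_le_mul_right ?_ _
          rw [← lintegral_indicator measurableSet_Icc, ← lintegral_indicator measurableSet_Ico,
            ← lintegral_add_right_eq_self (indicator (Ico (-T') 0) fun t => H t) τ]
          refine lintegral_mono fun t => ?_
          by_cases ht : t ∈ Icc (-T) 0
          · have : t + τ ∈ Ico (-T') 0 := by
              constructor
              · have := ht.1; have := le_abs_self T; linarith
              · linarith [ht.2]
            rw [indicator_of_mem ht, indicator_of_mem this]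
          · rw [indicator_of_notMem ht]; simp
      _ < ⊤ := ENNReal.mul_lt_top ENNReal.ofReal_lt_top (lt_top_iff_ne_top.2 hEH)
  refine ((integrable_const (1:ℝ)).add sq).mono' gm (Filter.Eventually.of_forall fun x => ?_)
  simp only [Pi.add_apply, norm_eq_abs]
  rw [← sq_abs]
  nlinarith [sq_nonneg (|Function.uncurry g x| - 1), abs_nonneg (Function.uncurry g x)]

lemma toSol (β : ℝ) (hβ : -1 < β) (u : ℝ → ℝ → ℝ → ℝ)
    (hper : ∀ ρ θ t : ℝ, u ρ (θ + 2 * π) t = u ρ θ t)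
    (hbdd : ∃ M : ℝ, ∀ ρ θ t : ℝ, 0 < ρ → t < 0 → |u ρ θ t| ≤ M)
    (hx : ∀ t : ℝ, t < 0 → ContDiffOn ℝ 2 (fun p : ℝ × ℝ => u p.1 p.2 t)
      {p : ℝ × ℝ | 0 < p.1})
    (ht : ∀ ρ θ : ℝ, 0 < ρ → ContDiffOn ℝ 1 (fun t => u ρ θ t) (Set.Iio 0))
    (heq : ∀ ρ θ t : ℝ, 0 < ρ → t < 0 →
      deriv (fun s => u ρ θ s) t = coneLapT β u ρ θ t)
    (henergy : ∀ R T : ℝ, 0 < R → 0 < T →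
      (∃ E : ℝ≥0∞, E ≠ ⊤ ∧ ∀ t ∈ Set.Ico (-T) (0:ℝ),
        (∫⁻ θ in Icc (0:ℝ) (2 * π), ∫⁻ ρ in Ioo (0:ℝ) R,
          ENNReal.ofReal (gradSq β u ρ θ t * ((β + 1) * ρ))) ≤ E) ∧
      ((∫⁻ t in Set.Ico (-T) (0:ℝ), ∫⁻ θ in Icc (0:ℝ) (2 * π), ∫⁻ ρ in Ioo (0:ℝ) R,
          ENNReal.ofReal ((deriv (fun s => u ρ θ s) t) ^ 2 * ((β + 1) * ρ))) ≠ ⊤)) {M : ℝ}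
    (hM : ∀ ρ θ t : ℝ, 0 < ρ → t < 0 → |u ρ θ t| ≤ M) {τ : ℝ} (hτ : τ < 0) :
    Sol (((β + 1) ^ 2)⁻¹) M (fun t p => u (exp p.1) p.2 (t + τ))
      (fun t p => deriv (fun s => u (exp p.1) p.2 s) (t + τ)) := by
  have hb : 0 < β + 1 := by linarith
  have neg : ∀ t ≤ 0, t + τ < 0 := fun t ht => by linarith
  have gc : ∀ p : ℝ × ℝ, ContinuousOn (fun t => deriv (fun s => u (exp p.1) p.2 s) (t + τ)) (Iic 0) := by
    intro p
    exact ((ht (exp p.1) p.2 (exp_pos _)).continuousOn_deriv_of_isOpen isOpen_Iio le_rfl).comp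
      (f := fun t => t + τ) (by fun_prop) (fun t h => neg t h)
  have sm : ∀ t ≤ 0, ContDiff ℝ 2 (fun p : ℝ × ℝ => u (exp p.1) p.2 (t + τ)) := by
    intro t h
    exact (hx (t + τ) (neg t h)).comp_contDiff (f := fun p : ℝ × ℝ => (exp p.1, p.2))
      (by fun_prop) (fun p => exp_pos _)
  have pde : ∀ t ≤ 0, ∀ p : ℝ × ℝ, exp (2 * p.1) * deriv (fun s => u (exp p.1) p.2 s) (t + τ) =
      lap (((β + 1) ^ 2)⁻¹) (fun p : ℝ × ℝ => u (exp p.1) p.2 (t + τ)) p := by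
    rintro t h ⟨x, y⟩
    have hF := sm t h
    rw [heq _ _ _ (exp_pos _) (neg t h)]
    set F : ℝ × ℝ → ℝ := fun p : ℝ × ℝ => u (exp p.1) p.2 (t + τ) with hFdef
    have e1 : dx (dx F) (x, y) = deriv (fun r => deriv (fun r' => u (exp r') y (t + τ)) r) x := by
      rw [dx_eq ((dx_contDiff hF).differentiable (by norm_num) _)]
      congr 1
      funext r
      exact dx_eq (hF.differentiable (by norm_num) _)
    have e2 : dy (dy F) (x, y) = deriv (fun r => deriv (fun r' => u (exp x) r' (t + τ)) r) y := by
      rw [dy_eq ((dy_contDiff hF).differentiable (by norm_num) _)]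
      congr 1
      funext r
      exact dy_eq (hF.differentiable (by norm_num) _)
    have hw : ContDiffOn ℝ 2 (fun ρ => u ρ y (t + τ)) (Ioi 0) :=
      (hx (t + τ) (neg t h)).comp (f := fun ρ : ℝ => (ρ, y)) (by fun_prop) (fun ρ h => h)
    unfold lap coneLapT
    rw [e1, e2, log_deriv2 hw]
    have e : exp (2 * x) = exp x ^ 2 := by rw [← exp_nat_mul]; norm_num
    simp only [e]
    have := (exp_pos x).ne'
    field_simp
  refine ⟨?_, gc, sm, fun t h x y => hper _ _ _, fun t h p => hM _ _ _ (exp_pos _) (neg t h), pde, ?_⟩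
  · intro t h p
    have := ((ht (exp p.1) p.2 (exp_pos _)).differentiableOn (by norm_num) (t + τ)
      (neg t h)).differentiableAt (Iio_mem_nhds (neg t h))
    exact this.hasDerivAt.comp_add_const t τ
  · intro a T
    refine int_of (D := fun ρ θ t => deriv (fun s => u ρ θ s) t) hb hτ gc ?_
      (fun R T hR hT => (henergy R T hR hT).2)
    intro t h
    have : (fun p : ℝ × ℝ => deriv (fun s => u (exp p.1) p.2 s) (t + τ)) =
        fun p => exp (-(2 * p.1)) *
          lap (((β + 1) ^ 2)⁻¹) (fun p : ℝ × ℝ => u (exp p.1) p.2 (t + τ)) p := by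
      funext p
      rw [← pde t h p, ← mul_assoc, ← exp_add]
      simp
    rw [this]
    have := lap_cont (κ := ((β + 1) ^ 2)⁻¹) (sm t h)
    fun_prop

end ConeLiouville

/-- Liouville: a bounded ancient solution of the heat equation
`∂_t u = △̃u` on the infinite cone with locally finite energy is constant. -/
theorem stmt11 (β : ℝ) (hβ : -1 < β) (u : ℝ → ℝ → ℝ → ℝ)
    (hper : ∀ ρ θ t : ℝ, u ρ (θ + 2 * π) t = u ρ θ t)
    (hbdd : ∃ M : ℝ, ∀ ρ θ t : ℝ, 0 < ρ → t < 0 → |u ρ θ t| ≤ M)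
    (hx : ∀ t : ℝ, t < 0 → ContDiffOn ℝ 2 (fun p : ℝ × ℝ => u p.1 p.2 t)
      {p : ℝ × ℝ | 0 < p.1})
    (ht : ∀ ρ θ : ℝ, 0 < ρ → ContDiffOn ℝ 1 (fun t => u ρ θ t) (Set.Iio 0))
    (heq : ∀ ρ θ t : ℝ, 0 < ρ → t < 0 →
      deriv (fun s => u ρ θ s) t = coneLapT β u ρ θ t)
    (henergy : ∀ R T : ℝ, 0 < R → 0 < T →
      (∃ E : ℝ≥0∞, E ≠ ⊤ ∧ ∀ t ∈ Set.Ico (-T) (0:ℝ),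
        (∫⁻ θ in Icc (0:ℝ) (2 * π), ∫⁻ ρ in Ioo (0:ℝ) R,
          ENNReal.ofReal (gradSq β u ρ θ t * ((β + 1) * ρ))) ≤ E) ∧
      ((∫⁻ t in Set.Ico (-T) (0:ℝ), ∫⁻ θ in Icc (0:ℝ) (2 * π), ∫⁻ ρ in Ioo (0:ℝ) R,
          ENNReal.ofReal ((deriv (fun s => u ρ θ s) t) ^ 2 * ((β + 1) * ρ))) ≠ ⊤)) :
    ∃ c : ℝ, ∀ ρ θ t : ℝ, 0 < ρ → t < 0 → u ρ θ t = c := by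
  obtain ⟨M, hM⟩ := hbdd
  have hκ : 0 < ((β + 1) ^ 2)⁻¹ := by
    have : 0 < β + 1 := by linarith
    positivity
  have hπ := pi_pos
  -- values on the open fundamental domain
  have A : ∀ τ < 0, ∀ t ≤ τ, ∀ ρ > 0, ∀ θ ∈ Ioo 0 (2 * π), u ρ θ t = u 1 π τ := by
    intro τ hτ t htτ ρ hρ θ hθ
    have hS := ConeLiouville.toSol β hβ u hper ⟨M, hM⟩ hx ht heq henergy hM hτ
    have := ConeLiouville.liouville hκ hS (p := (log ρ, θ)) hθ (t := t - τ) (by linarith)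
    simpa [exp_log hρ] using this
  -- closed fundamental domain
  have B : ∀ τ < 0, ∀ t ≤ τ, ∀ ρ > 0, ∀ θ ∈ Icc 0 (2 * π), u ρ θ t = u 1 π τ := by
    intro τ hτ t htτ ρ hρ θ hθ
    have hc : Continuous (fun y => u ρ y t) := by
      rw [← continuousOn_univ]
      exact (hx t (by linarith)).continuousOn.comp (f := fun y : ℝ => (ρ, y)) (by fun_prop)
        (fun y _ => hρ)
    have hcl : IsClosed {y | u ρ y t = u 1 π τ} := isClosed_eq hc continuous_const
    have := hcl.closure_subset_iff.2 (A τ hτ t htτ ρ hρ)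
    apply this
    rw [closure_Ioo (by positivity)]
    exact hθ
  refine ⟨u 1 π (-1), ?_⟩
  intro ρ θ t hρ ht0
  have hp : Function.Periodic (fun y => u ρ y t) (2 * π) := fun y => hper ρ y t
  obtain ⟨y, hy, hyθ⟩ := hp.exists_mem_Ico₀ (by positivity) θ
  rw [show u ρ θ t = u ρ y t from hyθ]
  set τ := max t (-1) with hτ
  have hτ0 : τ < 0 := max_lt ht0 (by norm_num)
  rw [B τ hτ0 t (le_max_left _ _) ρ hρ y ⟨hy.1, hy.2.le⟩,
    ← B τ hτ0 (-1) (le_max_right _ _) 1 one_pos π ⟨hπ.le, by linarith⟩]
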